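/- Let d ≥ 1, V̄ = {t ∈ ℝ^d : |t| ≤ 1/4}, and let φ : ℝ^d → ℂ be bounded continuous with ‖φ‖^{V̄} < ∞. Then the following are equivalent: (a) there exists a linear functional ν : C_c(ℝ^d) → ℂ such that for every compact K ⊆ ℝ^d there is C_K with |ν(h)| ≤ C_K ‖h‖_∞ whenever supp(h) ⊆ K, and ν(h ∗ h̃) = (2π)^{−d} ∫_{ℝ^d} |ȟ(t)|² φ(t) dt for all h ∈ C_c(ℝ^d); (b) for every compactly supported continuous k : ℝ^d → ℂ of the form k(x) = ∫_{ℝ^d} e^{i x·t} dσ₀(t) for some finite complex Borel measure σ₀ on ℝ^d, there exists a finite complex Borel measure σ on ℝ^d with ∫_{ℝ^d} e^{−i x·t} dσ(x) = ∫_{ℝ^d} φ(t − s) dσ₀(s) for all t ∈ ℝ^d. -/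

import Mathlib

/-!
STATEMENT 19.  `ℝ^d` (`d ≥ 1`), self-dual via `(x,t) = e^{i x·t}`, with Haar
measures `dx` and `dt/(2π)^d`; `V̄ = {t : |t| ≤ 1/4}`.  For `φ : ℝ^d → ℂ`
bounded continuous with `‖φ‖^{V̄} < ∞`, the following are equivalent:
(a) there is a complex Radon measure `ν` on `ℝ^d` (a linear functional on
`C_c(ℝ^d, ℂ)` bounded on each compact) with
`ν(h ∗ h̃) = (2π)^{−d} ∫ |ȟ(t)|² φ(t) dt` for all `h ∈ C_c`;
(b) for every `k ∈ C_c(ℝ^d, ℂ)` of the form `k(x) = ∫ e^{i x·t} dσ₀(t)`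
(`σ₀ = g₀ dν₀` a finite complex Borel measure), there is a finite complex
Borel measure `σ = g₁ dν₁` with `σ̂(t) = (φ ∗ σ₀)(t)` for all `t`.
-/

open MeasureTheory Filter Topology
open scoped ENNReal ComplexConjugate CompactlySupported

/-- The dot product `x·t`, as a complex number. -/
noncomputable def dotc {d : ℕ} (x t : EuclideanSpace ℝ (Fin d)) : ℂ :=
  ((∑ j, x j * t j : ℝ) : ℂ)

/-- The self-duality pairing of `ℝ^d`: `(x,t) = e^{i x·t}`. -/
noncomputable def rdPair (d : ℕ) :
    EuclideanSpace ℝ (Fin d) → EuclideanSpace ℝ (Fin d) → ℂ :=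
  fun x t => Complex.exp (Complex.I * dotc x t)

/-- `‖φ‖^{E,s}` for a pairing `e` on an additive group. -/
noncomputable def bseNormAt {G Γ : Type*} [AddCommGroup Γ] (e : G → Γ → ℂ)
    (φ : Γ → ℂ) (E : Set Γ) (γ₀ : Γ) : ℝ≥0∞ :=
  ⨆ (s : Finset Γ) (c : Γ → ℂ) (_ : ↑s ⊆ (· + γ₀) '' E)
    (_ : ∀ x : G, ‖∑ γ ∈ s, c γ * e x γ‖ ≤ 1),
    ENNReal.ofReal ‖∑ γ ∈ s, c γ * φ γ‖

/-- `‖φ‖^E := sup_s ‖φ‖^{E,s}`. -/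
noncomputable def bseNorm {G Γ : Type*} [AddCommGroup Γ] (e : G → Γ → ℂ)
    (φ : Γ → ℂ) (E : Set Γ) : ℝ≥0∞ :=
  ⨆ γ₀ : Γ, bseNormAt e φ E γ₀

/-- The inverse Fourier transform `ȟ(t) = ∫ e^{i x·t} h(x) dx`. -/
noncomputable def invFourierRd {d : ℕ} (h : EuclideanSpace ℝ (Fin d) → ℂ) :
    EuclideanSpace ℝ (Fin d) → ℂ :=
  fun t => ∫ x, Complex.exp (Complex.I * dotc x t) * h x


section RieszPart
open scoped NNReal
variable {X : Type*} [TopologicalSpace X]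

/-- total variation functional -/
noncomputable def tvFun (ν : C_c(X, ℂ) →ₗ[ℂ] ℂ) (f : C_c(X, ℝ≥0)) : ℝ≥0 :=
  ⨆ g : {g : C_c(X, ℂ) // ∀ x, ‖g x‖₊ ≤ f x}, ‖ν g.1‖₊

def LocBdd (ν : C_c(X, ℂ) →ₗ[ℂ] ℂ) : Prop :=
  ∀ K : Set X, IsCompact K → ∃ C : ℝ, ∀ h : C_c(X, ℂ),
          tsupport h ⊆ K → ‖ν h‖ ≤ C * ⨆ x, ‖h x‖

lemma cc_bdd (f : C_c(X, ℝ≥0)) : ∃ M : ℝ≥0, ∀ x, f x ≤ M := by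
  obtain ⟨M, hM⟩ := f.hasCompactSupport.isCompact_range f.continuous |>.bddAbove
  exact ⟨M, fun x => hM ⟨x, rfl⟩⟩

lemma cc_bddC (f : C_c(X, ℂ)) : ∃ M : ℝ, ∀ x, ‖f x‖ ≤ M := by
  obtain ⟨M, hM⟩ := f.hasCompactSupport.exists_bound_of_continuous f.continuous
  exact ⟨M, hM⟩

lemma tv_bddAbove {ν : C_c(X, ℂ) →ₗ[ℂ] ℂ} (hν : LocBdd ν) (f : C_c(X, ℝ≥0)) :
    BddAbove (Set.range fun g : {g : C_c(X, ℂ) // ∀ x, ‖g x‖₊ ≤ f x} => ‖ν g.1‖₊) := by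
  obtain ⟨C, hC⟩ := hν (tsupport f) f.hasCompactSupport
  obtain ⟨M, hM⟩ := cc_bdd f
  refine ⟨(|C| * M).toNNReal, ?_⟩
  rintro _ ⟨⟨g, hg⟩, rfl⟩
  rw [← NNReal.coe_le_coe, coe_nnnorm, Real.coe_toNNReal _ (by positivity)]
  have h1 : tsupport g ⊆ tsupport f := by
    apply closure_mono
    intro x hx hfx
    have h2 := hg x
    rw [hfx] at h2
    exact hx (by simpa using h2)
  refine (hC g h1).trans ?_
  have h3 : (⨆ x, ‖g x‖) ≤ M := by
    apply Real.iSup_le _ M.2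
    intro x
    exact_mod_cast (hg x).trans (hM x)
  have h4 : 0 ≤ ⨆ x, ‖g x‖ := Real.iSup_nonneg (fun x => norm_nonneg _)
  calc C * ⨆ x, ‖g x‖ ≤ |C| * ⨆ x, ‖g x‖ := by gcongr; exact le_abs_self C
    _ ≤ |C| * M := by gcongr

lemma le_tv {ν : C_c(X, ℂ) →ₗ[ℂ] ℂ} (hν : LocBdd ν) (f : C_c(X, ℝ≥0)) (g : C_c(X, ℂ))
    (hg : ∀ x, ‖g x‖₊ ≤ f x) : ‖ν g‖₊ ≤ tvFun ν f :=
  le_ciSup (tv_bddAbove hν f) ⟨g, hg⟩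

lemma tv_le {ν : C_c(X, ℂ) →ₗ[ℂ] ℂ} (f : C_c(X, ℝ≥0)) (r : ℝ≥0)
    (h : ∀ g : C_c(X, ℂ), (∀ x, ‖g x‖₊ ≤ f x) → ‖ν g‖₊ ≤ r) : tvFun ν f ≤ r := by
  have : Nonempty {g : C_c(X, ℂ) // ∀ x, ‖g x‖₊ ≤ f x} := ⟨⟨0, by simp⟩⟩
  exact ciSup_le fun g => h g.1 g.2

lemma exists_split (f₁ f₂ : C_c(X, ℝ≥0)) (g : C_c(X, ℂ)) (hg : ∀ x, ‖g x‖₊ ≤ (f₁ + f₂) x) :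
    ∃ g₁ g₂ : C_c(X, ℂ), g = g₁ + g₂ ∧ (∀ x, ‖g₁ x‖₊ ≤ f₁ x) ∧ (∀ x, ‖g₂ x‖₊ ≤ f₂ x) := by
  have hq : ∀ x, ((f₁ x / (f₁ x + f₂ x) : ℝ≥0) : ℝ) ≤ 1 := by
    intro x
    have : f₁ x / (f₁ x + f₂ x) ≤ 1 := by
      apply div_le_one_of_le₀ (by simp) (by simp)
    exact_mod_cast this
  have hcont : Continuous fun x => g x * ((f₁ x / (f₁ x + f₂ x) : ℝ≥0) : ℂ) := by
    rw [continuous_iff_continuousAt]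
    intro x
    by_cases hx : f₁ x + f₂ x = 0
    · have hgx : g x = 0 := by
        have := hg x
        simp only [CompactlySupportedContinuousMap.coe_add, Pi.add_apply, hx] at this
        simpa using this
      unfold ContinuousAt
      simp only [hgx, zero_mul]
      have h0 : Tendsto (fun y => ‖g y‖) (𝓝 x) (𝓝 0) := by
        have := (g.continuous.norm).tendsto x
        simpa [hgx] using this
      apply squeeze_zero_norm _ h0
      intro y
      rw [norm_mul]
      have : ‖((f₁ y / (f₁ y + f₂ y) : ℝ≥0) : ℂ)‖ ≤ 1 := by
        have h := hq y
        rw [Complex.norm_of_nonneg (NNReal.coe_nonneg _)]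
        exact h
      exact mul_le_of_le_one_right (norm_nonneg _) this
    · refine g.continuous.continuousAt.mul ?_
      have h1 : ContinuousAt (fun y => f₁ y / (f₁ y + f₂ y)) x :=
        f₁.continuous.continuousAt.div₀
          (f₁.continuous.continuousAt.add f₂.continuous.continuousAt) hx
      exact (Complex.continuous_ofReal.continuousAt.comp
        (NNReal.continuous_coe.continuousAt.comp h1))
  let g₁ : C_c(X, ℂ) := ⟨⟨_, hcont⟩, g.hasCompactSupport.mul_right⟩
  have hg₁ : ∀ x, g₁ x = g x * ((f₁ x / (f₁ x + f₂ x) : ℝ≥0) : ℂ) := fun x => rfl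
  have key : ∀ (a b c : ℝ≥0), c ≤ a + b → c * (a / (a + b)) ≤ a := by
    intro a b c h
    by_cases h0 : a + b = 0
    · simp [h0]
    · calc c * (a / (a + b)) ≤ (a + b) * (a / (a + b)) := by gcongr
        _ = a := mul_div_cancel₀ _ h0
  have hnn : ∀ r : ℝ≥0, ‖(r : ℂ)‖₊ = r := by
    intro r; ext; simp
  refine ⟨g₁, g - g₁, by simp, ?_, ?_⟩
  · intro x
    rw [hg₁, nnnorm_mul, hnn]
    exact key _ _ _ (hg x)
  · intro x
    have h2 : (g - g₁) x = g x * ((f₂ x / (f₂ x + f₁ x) : ℝ≥0) : ℂ) := by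
      rw [CompactlySupportedContinuousMap.sub_apply, hg₁]
      by_cases hx : f₁ x + f₂ x = 0
      · have hgx : g x = 0 := by
          have := hg x
          simp only [CompactlySupportedContinuousMap.coe_add, Pi.add_apply, hx] at this
          simpa using this
        simp [hgx]
      · have hx' : ((f₁ x : ℝ) : ℂ) + ((f₂ x : ℝ) : ℂ) ≠ 0 := by
          exact_mod_cast hx
        rw [add_comm (f₂ x)]
        push_cast
        field_simp
        ring
    rw [h2, nnnorm_mul, hnn]
    apply key
    rw [add_comm]
    exact hg x

lemma exists_rot (z : ℂ) : ∃ a : ℂ, ‖a‖ = 1 ∧ a * z = ‖z‖ := by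
  by_cases h : z = 0
  · exact ⟨1, by simp [h]⟩
  · refine ⟨conj z / ‖z‖, ?_, ?_⟩
    · simp [h]
    · have : (‖z‖ : ℂ) ≠ 0 := by simpa using h
      field_simp
      rw [mul_comm, Complex.mul_conj, Complex.normSq_eq_norm_sq]
      push_cast; rfl

noncomputable def tvLin (ν : C_c(X, ℂ) →ₗ[ℂ] ℂ) (hν : LocBdd ν) :
    C_c(X, ℝ≥0) →ₗ[ℝ≥0] ℝ≥0 where
  toFun := tvFun ν
  map_add' f₁ f₂ := by
    apply le_antisymm
    · apply tv_le
      intro g hg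
      obtain ⟨g₁, g₂, rfl, h1, h2⟩ := exists_split f₁ f₂ g hg
      rw [map_add]
      exact (nnnorm_add_le _ _).trans (add_le_add (le_tv hν _ _ h1) (le_tv hν _ _ h2))
    · have h : ∀ g₁ : C_c(X, ℂ), (∀ x, ‖g₁ x‖₊ ≤ f₁ x) → ∀ g₂ : C_c(X, ℂ),
          (∀ x, ‖g₂ x‖₊ ≤ f₂ x) → ‖ν g₁‖₊ + ‖ν g₂‖₊ ≤ tvFun ν (f₁ + f₂) := by
        intro g₁ h₁ g₂ h₂
        obtain ⟨a, ha, ha'⟩ := exists_rot (ν g₁)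
        obtain ⟨b, hb, hb'⟩ := exists_rot (ν g₂)
        have h3 := le_tv hν (f₁ + f₂) (a • g₁ + b • g₂) (by
          intro x
          simp only [CompactlySupportedContinuousMap.coe_add, Pi.add_apply,
            CompactlySupportedContinuousMap.coe_smul, Pi.smul_apply, smul_eq_mul]
          refine (nnnorm_add_le _ _).trans ?_
          rw [nnnorm_mul, nnnorm_mul]
          have e1 : ‖a‖₊ = 1 := by ext; simpa using ha
          have e2 : ‖b‖₊ = 1 := by ext; simpa using hb
          rw [e1, e2, one_mul, one_mul]
          exact add_le_add (h₁ x) (h₂ x))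
        refine le_trans (le_of_eq ?_) h3
        rw [map_add, map_smul, map_smul, smul_eq_mul, smul_eq_mul, ha', hb']
        ext
        rw [coe_nnnorm, ← Complex.ofReal_add, Complex.norm_of_nonneg (by positivity)]
        simp
      have h1 : ∀ g₁ : C_c(X, ℂ), (∀ x, ‖g₁ x‖₊ ≤ f₁ x) →
          tvFun ν f₂ ≤ tvFun ν (f₁ + f₂) - ‖ν g₁‖₊ := by
        intro g₁ h₁
        apply tv_le
        intro g₂ h₂
        exact le_tsub_of_add_le_left (h g₁ h₁ g₂ h₂)
      have h0 : ∀ g₁ : C_c(X, ℂ), (∀ x, ‖g₁ x‖₊ ≤ f₁ x) → ‖ν g₁‖₊ ≤ tvFun ν (f₁ + f₂) := by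
        intro g₁ h₁
        simpa using h g₁ h₁ 0 (by simp)
      have h2 : tvFun ν f₂ ≤ tvFun ν (f₁ + f₂) := by simpa using h1 0 (by simp)
      have h4 : tvFun ν f₁ ≤ tvFun ν (f₁ + f₂) - tvFun ν f₂ := by
        apply tv_le
        intro g₁ h₁
        apply le_tsub_of_add_le_left
        rw [add_comm]
        have := h1 g₁ h₁
        rwa [le_tsub_iff_left (h0 g₁ h₁)] at this
      rw [le_tsub_iff_right h2] at h4
      exact h4
  map_smul' c f := by
    have key : ∀ (c : ℝ≥0) (f : C_c(X, ℝ≥0)), c ≠ 0 → tvFun ν (c • f) ≤ c * tvFun ν f := by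
      intro c f hc
      apply tv_le
      intro g hg
      have h := le_tv hν f (((c⁻¹ : ℝ≥0) : ℂ) • g) (by
        intro x
        have := hg x
        simp only [CompactlySupportedContinuousMap.coe_smul, Pi.smul_apply, smul_eq_mul] at this ⊢
        rw [nnnorm_mul]
        have e : ‖((c⁻¹ : ℝ≥0) : ℂ)‖₊ = c⁻¹ := by ext; simp
        rw [e, inv_mul_le_iff₀ (pos_iff_ne_zero.mpr hc)]
        exact this)
      rw [map_smul, nnnorm_smul] at h
      have e : ‖((c⁻¹ : ℝ≥0) : ℂ)‖₊ = c⁻¹ := by ext; simp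
      rwa [e, inv_mul_le_iff₀ (pos_iff_ne_zero.mpr hc)] at h
    by_cases hc : c = 0
    · subst hc
      simp only [zero_smul, RingHom.id_apply, smul_eq_mul, zero_mul]
      apply le_antisymm _ (zero_le)
      apply tv_le
      intro g hg
      have : g = 0 := by
        ext x
        simpa using hg x
      simp [this]
    · apply le_antisymm
      · exact key c f hc
      · have h := key c⁻¹ (c • f) (inv_ne_zero hc)
        rw [smul_smul, inv_mul_cancel₀ hc, one_smul] at h
        rwa [le_inv_mul_iff₀ (pos_iff_ne_zero.mpr hc)] at h

/-- multiplication of `C_c` function by a continuous function -/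
noncomputable def ccMul (k : C_c(X, ℂ)) (f : X → ℂ) (hf : Continuous f) : C_c(X, ℂ) :=
  ⟨⟨fun x => k x * f x, k.continuous.mul hf⟩, k.hasCompactSupport.mul_right⟩

/-- absolute value -/
noncomputable def ccAbs (k : C_c(X, ℂ)) : C_c(X, ℝ≥0) :=
  ⟨⟨fun x => ‖k x‖₊, k.continuous.nnnorm⟩, k.hasCompactSupport.comp_left (g := fun z => ‖z‖₊) (by simp)⟩

variable [T2Space X] [LocallyCompactSpace X] [MeasurableSpace X] [BorelSpace X]

lemma riesz_abs (ν : C_c(X, ℂ) →ₗ[ℂ] ℂ) (hν : LocBdd ν) :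
    ∃ μ : Measure X, IsFiniteMeasureOnCompacts μ ∧ ∀ g : C_c(X, ℂ), ‖ν g‖ ≤ ∫ x, ‖g x‖ ∂μ := by
  refine ⟨NNRealRMK.rieszMeasure (tvLin ν hν), inferInstance, fun g => ?_⟩
  have h := NNRealRMK.integral_rieszMeasure (tvLin ν hν) (ccAbs g)
  have h2 : ‖ν g‖₊ ≤ tvLin ν hν (ccAbs g) := le_tv hν _ _ (fun x => le_rfl)
  have h3 : ‖ν g‖ ≤ (tvLin ν hν (ccAbs g) : ℝ) := h2
  rw [← h] at h3
  exact h3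

end RieszPart


lemma riesz_rep {d : ℕ} (ν : C_c(EuclideanSpace ℝ (Fin d), ℂ) →ₗ[ℂ] ℂ) (hν : LocBdd ν)
    (k : C_c(EuclideanSpace ℝ (Fin d), ℂ)) :
    ∃ (μ : Measure (EuclideanSpace ℝ (Fin d))) (w : EuclideanSpace ℝ (Fin d) → ℂ),
      IsFiniteMeasure μ ∧ Integrable w μ ∧
      ∀ (f : EuclideanSpace ℝ (Fin d) → ℂ) (hf : Continuous f), (∃ C, ∀ x, ‖f x‖ ≤ C) →
        ν (ccMul k f hf) = ∫ x, f x * w x ∂μ := by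
  obtain ⟨μ, hμ, hle⟩ := riesz_abs ν hν
  set K := tsupport k with hK
  have hKc : IsCompact K := k.hasCompactSupport
  have hfin : IsFiniteMeasure (μ.restrict K) := ⟨by
    rw [Measure.restrict_apply_univ]; exact hKc.measure_lt_top⟩
  obtain ⟨B, hB⟩ := cc_bddC k
  have hB0 : 0 ≤ B := (norm_nonneg _).trans (hB 0)
  let T := BoundedContinuousFunction.toLp (E := ℂ) 2 (μ.restrict K) ℂ
  let M : (BoundedContinuousFunction (EuclideanSpace ℝ (Fin d)) ℂ) →ₗ[ℂ] ℂ :=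
    { toFun := fun f => ν (ccMul k f f.continuous)
      map_add' := by
        intro f g
        rw [← map_add]
        congr 1
        ext x
        simp [ccMul, mul_add]
      map_smul' := by
        intro c f
        rw [RingHom.id_apply, ← map_smul]
        congr 1
        ext x
        simp [ccMul]
        ring }
  have hM : ∀ f : BoundedContinuousFunction (EuclideanSpace ℝ (Fin d)) ℂ,
      ‖M f‖ ≤ (B * ((μ.restrict K) Set.univ ^ (1 / (1 : ℝ≥0∞).toReal - 1 / (2 : ℝ≥0∞).toReal)).toReal)
        * ‖T f‖ := by
    intro f
    have hfm : AEStronglyMeasurable f (μ.restrict K) := f.continuous.aestronglyMeasurable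
    have hf2 : MemLp f 2 (μ.restrict K) := by
      apply MemLp.of_bound hfm ‖f‖
      exact Eventually.of_forall f.norm_coe_le_norm
    have hf1 : MemLp f 1 (μ.restrict K) := by
      apply MemLp.of_bound hfm ‖f‖
      exact Eventually.of_forall f.norm_coe_le_norm
    have h1 : ‖M f‖ ≤ ∫ x, ‖k x * f x‖ ∂μ := hle (ccMul k f f.continuous)
    have h2 : ∫ x, ‖k x * f x‖ ∂μ = ∫ x in K, ‖k x * f x‖ ∂μ := by
      rw [setIntegral_eq_integral_of_forall_compl_eq_zero]
      intro x hx
      rw [image_eq_zero_of_notMem_tsupport hx]; simp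
    have h3 : ∫ x in K, ‖k x * f x‖ ∂μ ≤ ∫ x in K, B * ‖f x‖ ∂μ := by
      apply integral_mono_of_nonneg
      · exact Eventually.of_forall fun x => norm_nonneg _
      · exact ((memLp_one_iff_integrable.mp hf1).norm.const_mul B)
      · refine Eventually.of_forall fun x => ?_
        simp only [norm_mul]
        gcongr
        exact hB x
    have h4 : ∫ x in K, ‖f x‖ ∂μ = (eLpNorm f 1 (μ.restrict K)).toReal := by
      rw [eLpNorm_one_eq_lintegral_enorm, integral_norm_eq_lintegral_enorm hfm]
    have h5 : ‖T f‖ = (eLpNorm f 2 (μ.restrict K)).toReal := by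
      rw [Lp.norm_def, eLpNorm_congr_ae (BoundedContinuousFunction.coeFn_toLp 2 (μ.restrict K) ℂ f)]
    have h6 := eLpNorm_le_eLpNorm_mul_rpow_measure_univ (μ := μ.restrict K) (f := f) (p := 1) (q := 2) (by norm_num) hfm
    have h7 : (eLpNorm f 1 (μ.restrict K)).toReal ≤ (eLpNorm f 2 (μ.restrict K)).toReal *
        ((μ.restrict K) Set.univ ^ (1 / (1 : ℝ≥0∞).toReal - 1 / (2 : ℝ≥0∞).toReal)).toReal := by
      rw [← ENNReal.toReal_mul]
      apply ENNReal.toReal_mono _ h6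
      apply ENNReal.mul_ne_top hf2.2.ne
      apply ENNReal.rpow_ne_top_of_nonneg (by norm_num) (measure_ne_top _ _)
    rw [integral_const_mul] at h3
    calc ‖M f‖ ≤ B * ∫ x in K, ‖f x‖ ∂μ := (h1.trans_eq h2).trans h3
      _ ≤ _ := by
        rw [h4, h5, mul_assoc]
        gcongr
        rw [mul_comm]; exact h7
  have hdense : DenseRange T := BoundedContinuousFunction.toLp_denseRange ℂ (μ.restrict K) ℂ (by norm_num)
  let N := M.extendOfNorm T.toLinearMap
  have hN : ∀ f, N (T f) = M f := fun f => LinearMap.extendOfNorm_eq (e := T.toLinearMap) hdense ⟨_, hM⟩ f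
  let w := (InnerProductSpace.toDual ℂ (Lp ℂ 2 (μ.restrict K))).symm N
  have hw1 : Integrable w (μ.restrict K) :=
    memLp_one_iff_integrable.mp ((Lp.memLp w).mono_exponent (by norm_num))
  refine ⟨μ.restrict K, fun x => conj (w x), hfin, ?_, ?_⟩
  · exact (LinearIsometryEquiv.integrable_comp_iff (Complex.conjLIE)).mpr hw1
  · intro f hf ⟨C, hC⟩
    let f' : BoundedContinuousFunction (EuclideanSpace ℝ (Fin d)) ℂ :=
      BoundedContinuousFunction.ofNormedAddCommGroup f hf C hC
    have h1 : ν (ccMul k f hf) = M f' := rfl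
    rw [h1, ← hN, ← InnerProductSpace.toDual_symm_apply, L2.inner_def]
    apply integral_congr_ae
    filter_upwards [BoundedContinuousFunction.coeFn_toLp 2 (μ.restrict K) ℂ f'] with x hx
    have : (T f' : EuclideanSpace ℝ (Fin d) → ℂ) x = f x := hx
    rw [this]
    simp [w]


section FourierPart
open scoped FourierTransform Convolution ContDiff

variable {d : ℕ}

lemma dotc_eq (x t : EuclideanSpace ℝ (Fin d)) : dotc x t = ((inner ℝ x t : ℝ) : ℂ) := by
  unfold dotc
  congr 1
  rw [PiLp.inner_apply]
  apply Finset.sum_congr rfl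
  intro i _
  simp [mul_comm]

lemma dotc_neg_left (x t : EuclideanSpace ℝ (Fin d)) : dotc (-x) t = - dotc x t := by
  simp [dotc_eq]

lemma dotc_neg_right (x t : EuclideanSpace ℝ (Fin d)) : dotc x (-t) = - dotc x t := by
  simp [dotc_eq]

lemma dotc_comm (x t : EuclideanSpace ℝ (Fin d)) : dotc x t = dotc t x := by
  simp [dotc_eq, real_inner_comm]

lemma dotc_add_right (x t s : EuclideanSpace ℝ (Fin d)) : dotc x (t + s) = dotc x t + dotc x s := by
  simp [dotc_eq, inner_add_right]

lemma dotc_add_left (x t s : EuclideanSpace ℝ (Fin d)) : dotc (x + t) s = dotc x s + dotc t s := by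
  simp [dotc_eq, inner_add_left]

lemma dotc_sub_left (x t s : EuclideanSpace ℝ (Fin d)) : dotc (x - t) s = dotc x s - dotc t s := by
  simp [dotc_eq, inner_sub_left]

lemma dotc_continuous : Continuous fun p : EuclideanSpace ℝ (Fin d) × EuclideanSpace ℝ (Fin d) =>
    dotc p.1 p.2 := by
  simp only [dotc_eq]
  fun_prop

@[fun_prop]
lemma Continuous.dotc' {Y : Type*} [TopologicalSpace Y] {a b : Y → EuclideanSpace ℝ (Fin d)}
    (ha : Continuous a) (hb : Continuous b) : Continuous fun y => dotc (a y) (b y) :=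
  dotc_continuous.comp (ha.prodMk hb)

lemma norm_exp_dotc (x t : EuclideanSpace ℝ (Fin d)) : ‖Complex.exp (Complex.I * dotc x t)‖ = 1 := by
  rw [dotc_eq, mul_comm, Complex.norm_exp_ofReal_mul_I]

lemma norm_exp_neg_dotc (x t : EuclideanSpace ℝ (Fin d)) :
    ‖Complex.exp (-(Complex.I * dotc x t))‖ = 1 := by
  have := norm_exp_dotc (-x) t
  rwa [dotc_neg_left, mul_neg] at this

lemma conj_exp_dotc (x t : EuclideanSpace ℝ (Fin d)) :
    conj (Complex.exp (Complex.I * dotc x t)) = Complex.exp (-(Complex.I * dotc x t)) := by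
  rw [← Complex.exp_conj, map_mul, Complex.conj_I, dotc_eq, Complex.conj_ofReal, neg_mul]

lemma integrable_exp_mul {Y : Type*} [MeasurableSpace Y] {μ : Measure Y} {e g : Y → ℂ}
    (he : AEStronglyMeasurable e μ) (he1 : ∀ y, ‖e y‖ ≤ 1) (hg : Integrable g μ) :
    Integrable (fun y => e y * g y) μ :=
  hg.bdd_mul he (Eventually.of_forall he1)

lemma inv_eq (h : EuclideanSpace ℝ (Fin d) → ℂ) (t : EuclideanSpace ℝ (Fin d)) :
    invFourierRd h ((2 * Real.pi) • t) = 𝓕⁻ h t := by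
  rw [invFourierRd, Real.fourierInv_eq']
  apply integral_congr_ae
  refine Eventually.of_forall fun x => ?_
  simp only [smul_eq_mul]
  congr 2
  rw [dotc_eq, inner_smul_right]
  push_cast
  ring

lemma two_pi_ne : (2 * Real.pi) ≠ 0 := by positivity

lemma inv_integrable_iff (h : EuclideanSpace ℝ (Fin d) → ℂ) :
    Integrable (invFourierRd h) ↔ Integrable (𝓕⁻ h) := by
  have : (𝓕⁻ h) = fun t => invFourierRd h ((2 * Real.pi) • t) := by
    ext t; rw [inv_eq]
  rw [this, integrable_comp_smul_iff _ _ two_pi_ne]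

lemma integral_two_pi (G : EuclideanSpace ℝ (Fin d) → ℂ) :
    ∫ t, G ((2 * Real.pi) • t) = (((2 * Real.pi) ^ d)⁻¹ : ℝ) * ∫ t, G t := by
  rw [Measure.integral_comp_smul, finrank_euclideanSpace_fin, abs_of_pos (by positivity)]
  simp

lemma inv_inversion {f : EuclideanSpace ℝ (Fin d) → ℂ} (hf : Continuous f) (hfi : Integrable f)
    (hfi' : Integrable (invFourierRd f)) (x : EuclideanSpace ℝ (Fin d)) :
    f x = (((2 * Real.pi) ^ d)⁻¹ : ℝ) *
      ∫ t, Complex.exp (-(Complex.I * dotc x t)) * invFourierRd f t := by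
  have h0 : Integrable (𝓕 f) := by
    have := ((inv_integrable_iff f).mp hfi').comp_neg
    refine this.congr (Eventually.of_forall fun w => ?_)
    simp only
    rw [Real.fourierInv_eq_fourier_neg, neg_neg]
  have h1 := hf.fourier_fourierInv_eq hfi h0
  rw [← integral_two_pi]
  conv_lhs => rw [← h1]
  rw [Real.fourier_eq']
  apply integral_congr_ae
  refine Eventually.of_forall fun t => ?_
  simp only [smul_eq_mul]
  rw [inv_eq]
  congr 2
  rw [dotc_eq, inner_smul_right, real_inner_comm]
  push_cast
  ring

lemma inv_integrable_of_smooth {f : EuclideanSpace ℝ (Fin d) → ℂ} (hf : ContDiff ℝ ∞ f)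
    (hc : HasCompactSupport f) : Integrable (invFourierRd f) := by
  rw [inv_integrable_iff]
  have h := (𝓕⁻ (hc.toSchwartzMap hf)).integrable (μ := volume)
  rw [SchwartzMap.fourierInv_coe] at h
  exact h

lemma inv_norm_le (f : EuclideanSpace ℝ (Fin d) → ℂ) (t : EuclideanSpace ℝ (Fin d)) :
    ‖invFourierRd f t‖ ≤ ∫ x, ‖f x‖ := by
  refine (norm_integral_le_integral_norm _).trans (le_of_eq ?_)
  simp only [norm_mul, norm_exp_dotc, one_mul]

lemma inv_continuous {f : EuclideanSpace ℝ (Fin d) → ℂ} (hf : Integrable f) :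
    Continuous (invFourierRd f) := by
  unfold invFourierRd
  apply continuous_of_dominated (bound := fun x => ‖f x‖)
  · intro t
    exact (by fun_prop : Continuous fun x => Complex.exp (Complex.I * dotc x t)).aestronglyMeasurable.mul hf.1
  · intro t
    refine Eventually.of_forall fun x => ?_
    rw [norm_mul, norm_exp_dotc, one_mul]
  · exact hf.norm
  · refine Eventually.of_forall fun x => ?_
    fun_prop

lemma cs_integrable {f : EuclideanSpace ℝ (Fin d) → ℂ} (hf : Continuous f)
    (hc : HasCompactSupport f) : Integrable f := hf.integrable_of_hasCompactSupport hc

lemma plancherel_smooth {f : EuclideanSpace ℝ (Fin d) → ℂ} (hf : ContDiff ℝ ∞ f)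
    (hc : HasCompactSupport f) :
    ∫⁻ t, ENNReal.ofReal (‖invFourierRd f ((2 * Real.pi) • t)‖ ^ 2) = ENNReal.ofReal (∫ x, ‖f x‖ ^ 2) := by
  have h := SchwartzMap.integral_norm_sq_fourier (𝓕⁻ (hc.toSchwartzMap hf))
  rw [FourierTransform.fourier_fourierInv_eq] at h
  have h2 : Integrable (fun t => ‖(𝓕⁻ (hc.toSchwartzMap hf)) t‖ ^ 2) := by
    have := (SchwartzMap.memLp (𝓕⁻ (hc.toSchwartzMap hf)) 2 (μ := volume))
    exact (memLp_two_iff_integrable_sq_norm this.1).mp this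
  have h3 : ∀ t, invFourierRd f ((2 * Real.pi) • t) = (𝓕⁻ (hc.toSchwartzMap hf)) t := by
    intro t
    rw [inv_eq, SchwartzMap.fourierInv_coe]
    rfl
  simp only [h3]
  rw [← ofReal_integral_eq_lintegral_ofReal h2 (Eventually.of_forall fun t => by positivity), ← h]
  rfl

/-- `(h ∗ g̃)(x)` -/
noncomputable def cv (h g : EuclideanSpace ℝ (Fin d) → ℂ) (x : EuclideanSpace ℝ (Fin d)) : ℂ :=
  ∫ y, h y * conj (g (y - x))

lemma cv_eq (h g : EuclideanSpace ℝ (Fin d) → ℂ) :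
    cv h g = h ⋆[ContinuousLinearMap.mul ℝ ℂ, volume] (fun x => conj (g (-x))) := by
  ext x
  simp [cv, convolution_def]

lemma conj_neg_cont {g : EuclideanSpace ℝ (Fin d) → ℂ} (hg : Continuous g) :
    Continuous (fun x => conj (g (-x))) := by
  exact Complex.continuous_conj.comp (hg.comp continuous_neg)

lemma conj_neg_cs {g : EuclideanSpace ℝ (Fin d) → ℂ} (hg : HasCompactSupport g) :
    HasCompactSupport (fun x => conj (g (-x))) := by
  have : HasCompactSupport (fun x => g (-x)) :=
    hg.comp_homeomorph (Homeomorph.neg (EuclideanSpace ℝ (Fin d)))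
  exact this.comp_left (g := fun z : ℂ => conj z) (by simp)

lemma cv_cont {h g : EuclideanSpace ℝ (Fin d) → ℂ} (hh : Continuous h)
    (hg : Continuous g) (hgc : HasCompactSupport g) : Continuous (cv h g) := by
  rw [cv_eq]
  exact (conj_neg_cs hgc).continuous_convolution_right _ (hh.locallyIntegrable) (conj_neg_cont hg)

lemma cv_cs {h g : EuclideanSpace ℝ (Fin d) → ℂ} (hhc : HasCompactSupport h)
    (hgc : HasCompactSupport g) : HasCompactSupport (cv h g) := by
  rw [cv_eq]
  exact hhc.convolution (ContinuousLinearMap.mul ℝ ℂ) (conj_neg_cs hgc)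

lemma inv_cv {h g : EuclideanSpace ℝ (Fin d) → ℂ} (hh : Integrable h) (hg : Integrable g)
    (u : EuclideanSpace ℝ (Fin d)) :
    invFourierRd (cv h g) u = invFourierRd h u * conj (invFourierRd g u) := by
  have hg' : Integrable (fun x => conj (g (-x))) :=
    (LinearIsometryEquiv.integrable_comp_iff (Complex.conjLIE)).mpr hg.comp_neg
  have hint := hh.convolution_integrand (μ := volume) (ν := volume) (ContinuousLinearMap.mul ℝ ℂ) hg'
  have hint2 : Integrable (Function.uncurry fun x y : EuclideanSpace ℝ (Fin d) =>
      Complex.exp (Complex.I * dotc x u) * (h y * conj (g (y - x)))) (volume.prod volume) := by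
    have : Integrable (fun p : EuclideanSpace ℝ (Fin d) × EuclideanSpace ℝ (Fin d) =>
      Complex.exp (Complex.I * dotc p.1 u) * (ContinuousLinearMap.mul ℝ ℂ (h p.2) (conj (g (-(p.1 - p.2)))))) (volume.prod volume) := by
      apply hint.bdd_mul (c := 1)
      · exact (by fun_prop : Continuous fun p : EuclideanSpace ℝ (Fin d) × EuclideanSpace ℝ (Fin d) =>
          Complex.exp (Complex.I * dotc p.1 u)).aestronglyMeasurable
      · exact Eventually.of_forall fun p => (norm_exp_dotc _ _).le
    refine this.congr (Eventually.of_forall fun p => ?_)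
    simp [Function.uncurry]
  calc invFourierRd (cv h g) u
      = ∫ x, ∫ y, Complex.exp (Complex.I * dotc x u) * (h y * conj (g (y - x))) := by
        simp only [invFourierRd, cv, integral_const_mul]
    _ = ∫ y, ∫ x, Complex.exp (Complex.I * dotc x u) * (h y * conj (g (y - x))) :=
        integral_integral_swap hint2
    _ = ∫ y, (Complex.exp (Complex.I * dotc y u) * h y) * conj (invFourierRd g u) := by
        apply integral_congr_ae
        refine Eventually.of_forall fun y => ?_
        simp only
        rw [← integral_sub_left_eq_self _ volume y, invFourierRd, ← integral_conj, ← integral_const_mul]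
        apply integral_congr_ae
        refine Eventually.of_forall fun x => ?_
        simp only [sub_sub_cancel, map_mul]
        rw [conj_exp_dotc, dotc_sub_left, mul_sub, Complex.exp_sub, Complex.exp_neg]
        field_simp
    _ = _ := by rw [integral_mul_const]; rfl

end FourierPart


section MollPart
open scoped FourierTransform Convolution ContDiff

variable {d : ℕ}

/-- small bumps -/
noncomputable def bmp (d n : ℕ) : ContDiffBump (0 : EuclideanSpace ℝ (Fin d)) :=
  ⟨1 / (2 * ((n : ℝ) + 1)), 1 / ((n : ℝ) + 1), by positivity, by
    apply one_div_lt_one_div_of_lt <;> [positivity; linarith [(Nat.cast_nonneg n : (0:ℝ) ≤ n)]]⟩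

lemma bmp_rOut (n : ℕ) : (bmp d n).rOut = 1 / ((n : ℝ) + 1) := rfl

lemma bmp_tendsto : Tendsto (fun n => (bmp d n).rOut) atTop (𝓝 0) := by
  simp only [bmp_rOut]
  exact tendsto_one_div_add_atTop_nhds_zero_nat

/-- large bumps -/
noncomputable def bigb (d n : ℕ) : ContDiffBump (0 : EuclideanSpace ℝ (Fin d)) :=
  ⟨(n : ℝ) + 1, (n : ℝ) + 2, by positivity, by linarith⟩

lemma bigb_one (n : ℕ) (x : EuclideanSpace ℝ (Fin d)) (hx : ‖x‖ ≤ n + 1) : bigb d n x = 1 := by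
  apply ContDiffBump.one_of_mem_closedBall
  rw [Metric.mem_closedBall, dist_zero_right]
  exact hx

/-- the complex-valued mollifier -/
noncomputable def rhoc (d n : ℕ) (x : EuclideanSpace ℝ (Fin d)) : ℂ :=
  (((bmp d n).normed volume x : ℝ) : ℂ)

lemma rhoc_contDiff (n : ℕ) : ContDiff ℝ ∞ (rhoc d n) :=
  Complex.ofRealCLM.contDiff.comp (bmp d n).contDiff_normed

lemma rhoc_cs (n : ℕ) : HasCompactSupport (rhoc d n) :=
  (bmp d n).hasCompactSupport_normed.comp_left (g := fun r : ℝ => (r : ℂ)) (by simp)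

lemma rhoc_cont (n : ℕ) : Continuous (rhoc d n) := (rhoc_contDiff n).continuous

lemma rhoc_norm_int (n : ℕ) : ∫ x, ‖rhoc d n x‖ = 1 := by
  rw [← (bmp d n).integral_normed (μ := volume)]
  congr 1
  ext x
  rw [rhoc, Complex.norm_of_nonneg ((bmp d n).nonneg_normed x)]

lemma cv_rhoc (n : ℕ) (g : EuclideanSpace ℝ (Fin d) → ℂ) :
    cv g (rhoc d n) = (bmp d n).normed volume ⋆[ContinuousLinearMap.lsmul ℝ ℝ, volume] g := by
  ext x
  rw [convolution_def, cv, ← integral_sub_left_eq_self _ volume x]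
  apply integral_congr_ae
  refine Eventually.of_forall fun y => ?_
  simp only [rhoc, Complex.conj_ofReal, ContinuousLinearMap.lsmul_apply, Complex.real_smul]
  rw [show x - y - x = -y by abel, ContDiffBump.normed_neg, mul_comm]

lemma cv_rhoc_contDiff (n : ℕ) {g : EuclideanSpace ℝ (Fin d) → ℂ} (hg : Continuous g) :
    ContDiff ℝ ∞ (cv g (rhoc d n)) := by
  rw [cv_rhoc]
  exact (bmp d n).hasCompactSupport_normed.contDiff_convolution_left _ (bmp d n).contDiff_normed
    hg.locallyIntegrable

lemma cv_rhoc_bound (n : ℕ) {g : EuclideanSpace ℝ (Fin d) → ℂ} {C : ℝ} (hC : ∀ x, ‖g x‖ ≤ C)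
    (x : EuclideanSpace ℝ (Fin d)) : ‖cv g (rhoc d n) x‖ ≤ C := by
  rw [cv]
  have hi : Integrable (fun y => C * ‖rhoc d n (y - x)‖) :=
    (((cs_integrable (rhoc_cont n) (rhoc_cs n)).comp_sub_right x).norm.const_mul C)
  calc ‖∫ y, g y * conj (rhoc d n (y - x))‖ ≤ ∫ y, C * ‖rhoc d n (y - x)‖ := by
        apply norm_integral_le_of_norm_le hi
        refine Eventually.of_forall fun y => ?_
        rw [norm_mul, RCLike.norm_conj]
        gcongr
        exact hC y
    _ = C := by
        rw [integral_const_mul, integral_sub_right_eq_self (fun y => ‖rhoc d n y‖), rhoc_norm_int, mul_one]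

lemma rhoc_zero (n : ℕ) (x : EuclideanSpace ℝ (Fin d)) (hx : 1 ≤ ‖x‖) : rhoc d n x = 0 := by
  have : x ∉ Function.support ((bmp d n).normed volume) := by
    rw [ContDiffBump.support_normed_eq]
    simp only [Metric.mem_ball, dist_zero_right, not_lt]
    refine le_trans ?_ hx
    rw [bmp_rOut, div_le_one (by positivity)]
    linarith [(Nat.cast_nonneg n : (0:ℝ) ≤ n)]
  rw [Function.notMem_support] at this
  simp [rhoc, this]

lemma cv_rhoc_supp (n : ℕ) {g : EuclideanSpace ℝ (Fin d) → ℂ} {R : ℝ}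
    (hR : ∀ x, R < ‖x‖ → g x = 0) (x : EuclideanSpace ℝ (Fin d)) (hx : R + 1 < ‖x‖) :
    cv g (rhoc d n) x = 0 := by
  rw [cv]
  convert integral_zero (EuclideanSpace ℝ (Fin d)) ℂ with y
  by_cases hy : R < ‖y‖
  · simp [hR y hy]
  · rw [rhoc_zero n (y - x), map_zero, mul_zero]
    have := norm_sub_norm_le x y
    rw [norm_sub_rev] at this
    linarith

lemma cv_rhoc_tendsto {g : ℕ → EuclideanSpace ℝ (Fin d) → ℂ} {x : EuclideanSpace ℝ (Fin d)} {z : ℂ}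
    (hg : ∀ n, Continuous (g n)) (h : Tendsto (Function.uncurry g) (atTop ×ˢ 𝓝 x) (𝓝 z)) :
    Tendsto (fun n => cv (g n) (rhoc d n) x) atTop (𝓝 z) := by
  simp only [cv_rhoc]
  exact ContDiffBump.convolution_tendsto_right bmp_tendsto
    (Eventually.of_forall fun n => (hg n).aestronglyMeasurable) h tendsto_const_nhds

lemma cv_rhoc_tendsto' {g : EuclideanSpace ℝ (Fin d) → ℂ} (x : EuclideanSpace ℝ (Fin d))
    (hg : Continuous g) :
    Tendsto (fun n => cv g (rhoc d n) x) atTop (𝓝 (g x)) :=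
  cv_rhoc_tendsto (fun _ => hg) ((hg.tendsto x).comp tendsto_snd)

lemma inv_rhoc_tendsto (u : EuclideanSpace ℝ (Fin d)) :
    Tendsto (fun n => invFourierRd (rhoc d n) u) atTop (𝓝 1) := by
  have h := cv_rhoc_tendsto' (d := d) (g := fun x => Complex.exp (Complex.I * dotc x u)) 0 (by fun_prop)
  have h0 : dotc (0 : EuclideanSpace ℝ (Fin d)) u = 0 := by simp [dotc_eq]
  rw [h0, mul_zero, Complex.exp_zero] at h
  refine h.congr fun n => ?_
  rw [cv, invFourierRd]
  apply integral_congr_ae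
  refine Eventually.of_forall fun y => ?_
  simp [rhoc]

lemma inv_rhoc_norm (n : ℕ) (u : EuclideanSpace ℝ (Fin d)) : ‖invFourierRd (rhoc d n) u‖ ≤ 1 := by
  rw [← rhoc_norm_int (d := d) n]
  exact inv_norm_le _ _

lemma cs_radius {f : EuclideanSpace ℝ (Fin d) → ℂ} (hc : HasCompactSupport f) :
    ∃ R : ℝ, 0 ≤ R ∧ ∀ x, R < ‖x‖ → f x = 0 := by
  obtain ⟨R, hR⟩ := (hc.isCompact.isBounded).subset_closedBall 0
  refine ⟨max R 0, le_max_right _ _, fun x hx => ?_⟩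
  apply image_eq_zero_of_notMem_tsupport
  intro h
  have := hR h
  simp only [Metric.mem_closedBall, dist_zero_right] at this
  exact absurd this (not_le.mpr (lt_of_le_of_lt (le_max_left _ _) hx))

lemma plancherel_int {f : EuclideanSpace ℝ (Fin d) → ℂ} (hf : Continuous f)
    (hc : HasCompactSupport f) : Integrable (fun t => ‖invFourierRd f t‖ ^ 2) := by
  have hfi := cs_integrable hf hc
  obtain ⟨B, hB⟩ := hc.exists_bound_of_continuous hf
  have hB0 : 0 ≤ B := (norm_nonneg _).trans (hB 0)
  obtain ⟨R, hR0, hR⟩ := cs_radius hc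
  rw [← integrable_comp_smul_iff _ _ two_pi_ne]
  have hcont : Continuous fun t => ‖invFourierRd f ((2 * Real.pi) • t)‖ ^ 2 :=
    ((inv_continuous hfi).comp (continuous_const_smul _)).norm.pow 2
  refine ⟨hcont.aestronglyMeasurable, ?_⟩
  rw [hasFiniteIntegral_iff_ofReal (Eventually.of_forall fun t => by positivity)]
  set Q : ℝ := ∫ x in Metric.closedBall (0 : EuclideanSpace ℝ (Fin d)) (R + 1), B ^ 2 with hQ
  have hn : ∀ n, ∫⁻ t, ENNReal.ofReal (‖invFourierRd (cv f (rhoc d n)) ((2 * Real.pi) • t)‖ ^ 2)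
      ≤ ENNReal.ofReal Q := by
    intro n
    rw [plancherel_smooth (cv_rhoc_contDiff n hf) (cv_cs hc (rhoc_cs n))]
    apply ENNReal.ofReal_le_ofReal
    rw [hQ, ← setIntegral_eq_integral_of_forall_compl_eq_zero
      (s := Metric.closedBall (0 : EuclideanSpace ℝ (Fin d)) (R + 1))]
    · apply integral_mono_of_nonneg
      · exact Eventually.of_forall fun x => by positivity
      · exact (integrableOn_const (C := B ^ 2) ((isCompact_closedBall _ _).measure_lt_top.ne))
      · refine Eventually.of_forall fun x => ?_
        simp only
        gcongr
        exact cv_rhoc_bound n hB x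
    · intro x hx
      simp only [Metric.mem_closedBall, dist_zero_right, not_le] at hx
      rw [cv_rhoc_supp n hR x hx]; simp
  have hlim : ∀ t, Tendsto (fun n => ENNReal.ofReal
      (‖invFourierRd (cv f (rhoc d n)) ((2 * Real.pi) • t)‖ ^ 2)) atTop
      (𝓝 (ENNReal.ofReal (‖invFourierRd f ((2 * Real.pi) • t)‖ ^ 2))) := by
    intro t
    apply (ENNReal.continuous_ofReal.tendsto _).comp
    have : ∀ n, invFourierRd (cv f (rhoc d n)) ((2 * Real.pi) • t) =
        invFourierRd f ((2 * Real.pi) • t) * conj (invFourierRd (rhoc d n) ((2 * Real.pi) • t)) :=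
      fun n => inv_cv hfi (cs_integrable (rhoc_cont n) (rhoc_cs n)) _
    simp only [this]
    have h1 := (Complex.continuous_conj.tendsto _).comp (inv_rhoc_tendsto ((2 * Real.pi) • t))
    have h2 := ((h1.const_mul (invFourierRd f ((2 * Real.pi) • t))).norm).pow 2
    simpa using h2
  calc ∫⁻ t, ENNReal.ofReal (‖invFourierRd f ((2 * Real.pi) • t)‖ ^ 2)
      = ∫⁻ t, liminf (fun n => ENNReal.ofReal
      (‖invFourierRd (cv f (rhoc d n)) ((2 * Real.pi) • t)‖ ^ 2)) atTop := by
        congr 1; ext t; exact (hlim t).liminf_eq.symm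
    _ ≤ liminf (fun n => ∫⁻ t, ENNReal.ofReal
      (‖invFourierRd (cv f (rhoc d n)) ((2 * Real.pi) • t)‖ ^ 2)) atTop := by
        apply lintegral_liminf_le
        intro n
        have : Continuous (cv f (rhoc d n)) := (cv_rhoc_contDiff n hf).continuous
        have h2 := (inv_continuous (cs_integrable this (cv_cs hc (rhoc_cs n))))
        exact (ENNReal.continuous_ofReal.comp
          ((h2.comp (continuous_const_smul _)).norm.pow 2)).measurable
    _ ≤ ENNReal.ofReal Q := by
        apply liminf_le_of_le
        · isBoundedDefault
        · intro b hb
          obtain ⟨n, hn'⟩ := hb.exists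
          exact hn'.trans (hn n)
    _ < ⊤ := ENNReal.ofReal_lt_top

/-- Bounded continuous functions are boundedly pointwise limits of test functions. -/
lemma exists_approx {F : EuclideanSpace ℝ (Fin d) → ℂ} (hF : Continuous F) {C : ℝ}
    (hC : ∀ x, ‖F x‖ ≤ C) :
    ∃ G : ℕ → EuclideanSpace ℝ (Fin d) → ℂ, (∀ n, ContDiff ℝ ∞ (G n)) ∧
      (∀ n, HasCompactSupport (G n)) ∧ (∀ n x, ‖G n x‖ ≤ C) ∧
      ∀ x, Tendsto (fun n => G n x) atTop (𝓝 (F x)) := by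
  have hb : ∀ n, Continuous fun x => F x * ((bigb d n x : ℝ) : ℂ) := fun n =>
    hF.mul (Complex.continuous_ofReal.comp (bigb d n).continuous)
  have hbc : ∀ n, HasCompactSupport fun x => F x * ((bigb d n x : ℝ) : ℂ) := fun n =>
    ((bigb d n).hasCompactSupport.comp_left (g := fun r : ℝ => (r : ℂ)) (by simp)).mul_left
  refine ⟨fun n => cv (fun x => F x * ((bigb d n x : ℝ) : ℂ)) (rhoc d n),
    fun n => cv_rhoc_contDiff n (hb n), fun n => cv_cs (hbc n) (rhoc_cs n),
    fun n x => cv_rhoc_bound n (fun x => ?_) x, fun x => cv_rhoc_tendsto hb ?_⟩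
  · rw [norm_mul, Complex.norm_of_nonneg (bigb d n).nonneg]
    exact (mul_le_of_le_one_right (norm_nonneg _) (bigb d n).le_one).trans (hC x)
  · have h1 : Tendsto (fun p : ℕ × EuclideanSpace ℝ (Fin d) => F p.2) (atTop ×ˢ 𝓝 x) (𝓝 (F x)) :=
      (hF.tendsto x).comp tendsto_snd
    refine h1.congr' ?_
    obtain ⟨N, hN⟩ := exists_nat_ge ‖x‖
    have h2 : ∀ᶠ y in 𝓝 x, ‖y‖ < N + 1 :=
      (continuous_norm.tendsto x).eventually_lt_const (by linarith)
    filter_upwards [(eventually_ge_atTop N).prod_mk h2] with p hp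
    have h3 : (N : ℝ) ≤ p.1 := by exact_mod_cast hp.1
    simp only [Function.uncurry]
    rw [bigb_one]
    · simp
    · linarith [hp.2]

end MollPart


section PairPart
open scoped FourierTransform Convolution ContDiff

variable {d : ℕ}

lemma prod_shift_int {ν₀ : Measure (EuclideanSpace ℝ (Fin d))} [IsFiniteMeasure ν₀]
    {g₀ F : EuclideanSpace ℝ (Fin d) → ℂ} (hg : Integrable g₀ ν₀) (hF : Integrable F) :
    Integrable (fun p : EuclideanSpace ℝ (Fin d) × EuclideanSpace ℝ (Fin d) =>
      g₀ p.1 * F (p.1 + p.2)) (ν₀.prod volume) :=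
  (measurePreserving_prod_add ν₀ volume).integrable_comp_of_integrable (hg.mul_prod hF)

/-- `(f k)ˇ` where `k = σ₀ˇ` -/
lemma inv_mul_eq {ν₀ : Measure (EuclideanSpace ℝ (Fin d))} [IsFiniteMeasure ν₀]
    {g₀ f k : EuclideanSpace ℝ (Fin d) → ℂ} (hg : Integrable g₀ ν₀) (hf : Integrable f)
    (hk : ∀ x, k x = ∫ t, Complex.exp (Complex.I * dotc x t) * g₀ t ∂ν₀)
    (u : EuclideanSpace ℝ (Fin d)) :
    invFourierRd (fun x => f x * k x) u = ∫ s, g₀ s * invFourierRd f (s + u) ∂ν₀ := by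
  have hint : Integrable (Function.uncurry fun x s : EuclideanSpace ℝ (Fin d) =>
      Complex.exp (Complex.I * dotc x (s + u)) * (f x * g₀ s)) (volume.prod ν₀) := by
    apply integrable_exp_mul _ _ (hf.mul_prod hg)
    · exact (by fun_prop : Continuous fun p : EuclideanSpace ℝ (Fin d) × EuclideanSpace ℝ (Fin d) =>
          Complex.exp (Complex.I * dotc p.1 (p.2 + u))).aestronglyMeasurable
    · intro p; exact (norm_exp_dotc _ _).le
  calc invFourierRd (fun x => f x * k x) u
      = ∫ x, ∫ s, Complex.exp (Complex.I * dotc x (s + u)) * (f x * g₀ s) ∂ν₀ := by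
        unfold invFourierRd
        apply integral_congr_ae
        refine Eventually.of_forall fun x => ?_
        simp only
        rw [hk, ← mul_assoc, ← integral_const_mul]
        apply integral_congr_ae
        refine Eventually.of_forall fun s => ?_
        simp only
        rw [dotc_add_right, mul_add, Complex.exp_add]
        ring
    _ = ∫ s, (∫ x, Complex.exp (Complex.I * dotc x (s + u)) * (f x * g₀ s)) ∂ν₀ :=
        integral_integral_swap hint
    _ = _ := by
        apply integral_congr_ae
        refine Eventually.of_forall fun s => ?_
        simp only [invFourierRd]
        rw [← integral_const_mul]
        apply integral_congr_ae
        refine Eventually.of_forall fun x => ?_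
        simp only
        ring

lemma inv_mul_integrable {ν₀ : Measure (EuclideanSpace ℝ (Fin d))} [IsFiniteMeasure ν₀]
    {g₀ f k : EuclideanSpace ℝ (Fin d) → ℂ} (hg : Integrable g₀ ν₀) (hf : Integrable f)
    (hF : Integrable (invFourierRd f))
    (hk : ∀ x, k x = ∫ t, Complex.exp (Complex.I * dotc x t) * g₀ t ∂ν₀) :
    Integrable (invFourierRd (fun x => f x * k x)) := by
  have := (prod_shift_int hg hF).integral_prod_right
  refine this.congr (Eventually.of_forall fun u => ?_)
  simp only
  rw [inv_mul_eq hg hf hk]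

lemma bigbc_contDiff (n : ℕ) : ContDiff ℝ ∞ (fun x => ((bigb d n x : ℝ) : ℂ)) :=
  Complex.ofRealCLM.contDiff.comp (bigb d n).contDiff

lemma bigbc_cs (n : ℕ) : HasCompactSupport (fun x => ((bigb d n x : ℝ) : ℂ)) :=
  (bigb d n).hasCompactSupport.comp_left (g := fun r : ℝ => (r : ℂ)) (by simp)

lemma inv_k_integrable {ν₀ : Measure (EuclideanSpace ℝ (Fin d))} [IsFiniteMeasure ν₀]
    {g₀ k : EuclideanSpace ℝ (Fin d) → ℂ} (hg : Integrable g₀ ν₀) (hkc : HasCompactSupport k)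
    (hk : ∀ x, k x = ∫ t, Complex.exp (Complex.I * dotc x t) * g₀ t ∂ν₀) :
    Integrable (invFourierRd k) := by
  obtain ⟨R, hR0, hR⟩ := cs_radius hkc
  obtain ⟨N, hN⟩ := exists_nat_ge R
  have hs := bigbc_contDiff (d := d) N
  have hc := bigbc_cs (d := d) N
  have h := inv_mul_integrable hg (cs_integrable hs.continuous hc) (inv_integrable_of_smooth hs hc) hk
  convert h using 3 with x
  by_cases hx : R < ‖x‖
  · simp [hR x hx]
  · rw [bigb_one]
    · simp
    · linarith

lemma pairing_A {φ : EuclideanSpace ℝ (Fin d) → ℂ} (hφc : Continuous φ) {C : ℝ}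
    (hφb : ∀ t, ‖φ t‖ ≤ C)
    {ν₀ ν₁ : Measure (EuclideanSpace ℝ (Fin d))} [IsFiniteMeasure ν₀] [IsFiniteMeasure ν₁]
    {g₀ g₁ f k : EuclideanSpace ℝ (Fin d) → ℂ} (hg : Integrable g₀ ν₀) (hg₁ : Integrable g₁ ν₁)
    (hk : ∀ x, k x = ∫ t, Complex.exp (Complex.I * dotc x t) * g₀ t ∂ν₀)
    (hσ : ∀ t, ∫ x, Complex.exp (-(Complex.I * dotc x t)) * g₁ x ∂ν₁ =
          ∫ s, φ (t - s) * g₀ s ∂ν₀)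
    (hfc : Continuous f) (hf : Integrable f) (hF : Integrable (invFourierRd f)) :
    ∫ x, f x * g₁ x ∂ν₁ = (((2 * Real.pi) ^ d)⁻¹ : ℝ) *
      ∫ u, invFourierRd (fun x => f x * k x) u * φ u := by
  set c : ℂ := ((((2 * Real.pi) ^ d)⁻¹ : ℝ) : ℂ) with hc
  have hint1 : Integrable (Function.uncurry fun x t : EuclideanSpace ℝ (Fin d) =>
      Complex.exp (-(Complex.I * dotc x t)) * (g₁ x * invFourierRd f t)) (ν₁.prod volume) := by
    apply integrable_exp_mul _ _ (hg₁.mul_prod hF)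
    · exact (by fun_prop : Continuous fun p : EuclideanSpace ℝ (Fin d) × EuclideanSpace ℝ (Fin d) =>
          Complex.exp (-(Complex.I * dotc p.1 p.2))).aestronglyMeasurable
    · intro p; exact (norm_exp_neg_dotc _ _).le
  have hint2 : Integrable (Function.uncurry fun t s : EuclideanSpace ℝ (Fin d) =>
      φ (t - s) * (invFourierRd f t * g₀ s)) (volume.prod ν₀) := by
    apply (hF.mul_prod hg).bdd_mul (c := C)
    · exact (by fun_prop : Continuous fun p : EuclideanSpace ℝ (Fin d) × EuclideanSpace ℝ (Fin d) =>
          φ (p.1 - p.2)).aestronglyMeasurable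
    · exact Eventually.of_forall fun p => hφb _
  have hint3 : Integrable (Function.uncurry fun s u : EuclideanSpace ℝ (Fin d) =>
      φ u * (g₀ s * invFourierRd f (s + u))) (ν₀.prod volume) := by
    apply (prod_shift_int hg hF).bdd_mul (c := C)
    · exact (by fun_prop : Continuous fun p : EuclideanSpace ℝ (Fin d) × EuclideanSpace ℝ (Fin d) =>
          φ p.2).aestronglyMeasurable
    · exact Eventually.of_forall fun p => hφb _
  calc ∫ x, f x * g₁ x ∂ν₁
      = ∫ x, (c * ∫ t, Complex.exp (-(Complex.I * dotc x t)) * (g₁ x * invFourierRd f t)) ∂ν₁ := by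
        apply integral_congr_ae
        refine Eventually.of_forall fun x => ?_
        simp only
        rw [inv_inversion hfc hf hF x, mul_assoc, ← integral_mul_const]
        congr 2
        ext t
        ring
    _ = c * ∫ t, ∫ x, Complex.exp (-(Complex.I * dotc x t)) * (g₁ x * invFourierRd f t) ∂ν₁ := by
        rw [integral_const_mul, integral_integral_swap hint1]
    _ = c * ∫ t, ∫ s, φ (t - s) * (invFourierRd f t * g₀ s) ∂ν₀ := by
        congr 2
        ext t
        calc ∫ x, Complex.exp (-(Complex.I * dotc x t)) * (g₁ x * invFourierRd f t) ∂ν₁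
            = (∫ x, Complex.exp (-(Complex.I * dotc x t)) * g₁ x ∂ν₁) * invFourierRd f t := by
              rw [← integral_mul_const]
              congr 1; ext x; ring
          _ = _ := by
              rw [hσ, ← integral_mul_const]
              congr 1; ext x; ring
    _ = c * ∫ s, (∫ t, φ (t - s) * (invFourierRd f t * g₀ s)) ∂ν₀ := by
        rw [integral_integral_swap hint2]
    _ = c * ∫ s, (∫ u, φ u * (g₀ s * invFourierRd f (s + u))) ∂ν₀ := by
        congr 2
        ext s
        rw [← integral_add_left_eq_self _ s]
        congr 1
        ext u
        rw [add_sub_cancel_left]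
        ring
    _ = c * ∫ u, ∫ s, φ u * (g₀ s * invFourierRd f (s + u)) ∂ν₀ := by
        rw [integral_integral_swap hint3]
    _ = _ := by
        congr 2
        ext u
        rw [integral_const_mul, inv_mul_eq hg hf hk, mul_comm]

lemma uniq_smooth {ν₀ : Measure (EuclideanSpace ℝ (Fin d))} [IsFiniteMeasure ν₀]
    {g₀ k F : EuclideanSpace ℝ (Fin d) → ℂ} (hg : Integrable g₀ ν₀) (hki : Integrable k)
    (hk : ∀ x, k x = ∫ t, Complex.exp (Complex.I * dotc x t) * g₀ t ∂ν₀)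
    (hF : ContDiff ℝ ∞ F) (hFc : HasCompactSupport F) :
    ∫ s, F s * g₀ s ∂ν₀ = (((2 * Real.pi) ^ d)⁻¹ : ℝ) * ∫ u, F (-u) * invFourierRd k u := by
  set c : ℂ := ((((2 * Real.pi) ^ d)⁻¹ : ℝ) : ℂ) with hc
  have hFi := cs_integrable hF.continuous hFc
  have hF' := inv_integrable_of_smooth hF hFc
  have hint1 : Integrable (Function.uncurry fun s t : EuclideanSpace ℝ (Fin d) =>
      Complex.exp (-(Complex.I * dotc s t)) * (g₀ s * invFourierRd F t)) (ν₀.prod volume) := by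
    apply integrable_exp_mul _ _ (hg.mul_prod hF')
    · exact (by fun_prop : Continuous fun p : EuclideanSpace ℝ (Fin d) × EuclideanSpace ℝ (Fin d) =>
          Complex.exp (-(Complex.I * dotc p.1 p.2))).aestronglyMeasurable
    · intro p; exact (norm_exp_neg_dotc _ _).le
  have hint2 : Integrable (Function.uncurry fun u x : EuclideanSpace ℝ (Fin d) =>
      Complex.exp (Complex.I * dotc x u) * (F (-u) * k x)) (volume.prod volume) := by
    apply integrable_exp_mul _ _ (hFi.comp_neg.mul_prod hki)
    · exact (by fun_prop : Continuous fun p : EuclideanSpace ℝ (Fin d) × EuclideanSpace ℝ (Fin d) =>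
          Complex.exp (Complex.I * dotc p.2 p.1)).aestronglyMeasurable
    · intro p; exact (norm_exp_dotc _ _).le
  have e1 : ∫ s, F s * g₀ s ∂ν₀ = c * ∫ t, k (-t) * invFourierRd F t := by
    calc ∫ s, F s * g₀ s ∂ν₀
        = ∫ s, (c * ∫ t, Complex.exp (-(Complex.I * dotc s t)) * (g₀ s * invFourierRd F t)) ∂ν₀ := by
          apply integral_congr_ae
          refine Eventually.of_forall fun s => ?_
          simp only
          rw [inv_inversion hF.continuous hFi hF' s, mul_assoc, ← integral_mul_const]
          congr 2
          ext t
          ring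
      _ = c * ∫ t, ∫ s, Complex.exp (-(Complex.I * dotc s t)) * (g₀ s * invFourierRd F t) ∂ν₀ := by
          rw [integral_const_mul, integral_integral_swap hint1]
      _ = _ := by
          congr 2
          ext t
          rw [hk, ← integral_mul_const]
          congr 1
          ext s
          rw [dotc_neg_left, dotc_comm t s, mul_neg]
          ring
  have e2 : ∫ u, F (-u) * invFourierRd k u = ∫ t, k (-t) * invFourierRd F t := by
    calc ∫ u, F (-u) * invFourierRd k u
        = ∫ u, ∫ x, Complex.exp (Complex.I * dotc x u) * (F (-u) * k x) := by
          congr 1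
          ext u
          rw [invFourierRd, ← integral_const_mul]
          congr 1
          ext x
          ring
      _ = ∫ x, ∫ u, Complex.exp (Complex.I * dotc x u) * (F (-u) * k x) :=
          integral_integral_swap hint2
      _ = ∫ x, k x * invFourierRd F (-x) := by
          congr 1
          ext x
          rw [invFourierRd, ← integral_const_mul, ← integral_neg_eq_self]
          congr 1
          ext u
          rw [neg_neg, dotc_neg_right, dotc_neg_right, dotc_comm]
          ring
      _ = _ := by
          rw [← integral_neg_eq_self]
          simp only [neg_neg]
  rw [e1, e2]

lemma uniq_general {ν₀ : Measure (EuclideanSpace ℝ (Fin d))} [IsFiniteMeasure ν₀]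
    {g₀ k F : EuclideanSpace ℝ (Fin d) → ℂ} (hg : Integrable g₀ ν₀) (hkc : Continuous k)
    (hkcs : HasCompactSupport k)
    (hk : ∀ x, k x = ∫ t, Complex.exp (Complex.I * dotc x t) * g₀ t ∂ν₀)
    (hF : Continuous F) {C : ℝ} (hC : ∀ x, ‖F x‖ ≤ C) :
    ∫ s, F s * g₀ s ∂ν₀ = (((2 * Real.pi) ^ d)⁻¹ : ℝ) * ∫ u, F (-u) * invFourierRd k u := by
  obtain ⟨G, hG1, hG2, hG3, hG4⟩ := exists_approx hF hC
  have hki := cs_integrable hkc hkcs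
  have hk' := inv_k_integrable hg hkcs hk
  have l1 : Tendsto (fun n => ∫ s, G n s * g₀ s ∂ν₀) atTop (𝓝 (∫ s, F s * g₀ s ∂ν₀)) := by
    apply tendsto_integral_of_dominated_convergence (fun s => C * ‖g₀ s‖)
    · intro n
      exact (hG1 n).continuous.aestronglyMeasurable.mul hg.1
    · exact hg.norm.const_mul C
    · intro n
      refine Eventually.of_forall fun s => ?_
      rw [norm_mul]
      gcongr
      exact hG3 n s
    · exact Eventually.of_forall fun s => (hG4 s).mul_const _
  have l2 : Tendsto (fun n => ∫ u, G n (-u) * invFourierRd k u) atTop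
      (𝓝 (∫ u, F (-u) * invFourierRd k u)) := by
    apply tendsto_integral_of_dominated_convergence (fun u => C * ‖invFourierRd k u‖)
    · intro n
      exact ((hG1 n).continuous.comp continuous_neg).aestronglyMeasurable.mul hk'.1
    · exact hk'.norm.const_mul C
    · intro n
      refine Eventually.of_forall fun s => ?_
      rw [norm_mul]
      gcongr
      exact hG3 n _
    · exact Eventually.of_forall fun s => (hG4 _).mul_const _
  have l3 := l2.const_mul ((((2 * Real.pi) ^ d)⁻¹ : ℝ) : ℂ)
  refine tendsto_nhds_unique l1 (l3.congr fun n => ?_)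
  rw [uniq_smooth hg hki hk (hG1 n) (hG2 n)]

end PairPart


section Forward
open scoped FourierTransform Convolution ContDiff

variable {d : ℕ}

/-- the correlation `h ⋆ g̃` as a compactly supported function -/
noncomputable def ccv (h g : C_c(EuclideanSpace ℝ (Fin d), ℂ)) : C_c(EuclideanSpace ℝ (Fin d), ℂ) :=
  ⟨⟨cv h g, cv_cont h.continuous g.continuous g.hasCompactSupport⟩,
    cv_cs h.hasCompactSupport g.hasCompactSupport⟩

lemma ccv_apply (h g : C_c(EuclideanSpace ℝ (Fin d), ℂ)) (x : EuclideanSpace ℝ (Fin d)) :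
    ccv h g x = ∫ y, h y * conj (g (y - x)) := rfl

lemma cc_int (h : C_c(EuclideanSpace ℝ (Fin d), ℂ)) : Integrable h :=
  cs_integrable h.continuous h.hasCompactSupport

lemma ccv_int (h g : C_c(EuclideanSpace ℝ (Fin d), ℂ)) (x : EuclideanSpace ℝ (Fin d)) :
    Integrable fun y => h y * conj (g (y - x)) := by
  apply cs_integrable
  · exact h.continuous.mul (Complex.continuous_conj.comp (g.continuous.comp (by fun_prop)))
  · exact h.hasCompactSupport.mul_right

lemma inv_lin (h g : C_c(EuclideanSpace ℝ (Fin d), ℂ)) (a : ℂ) (u : EuclideanSpace ℝ (Fin d)) :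
    invFourierRd (h + a • g : C_c(EuclideanSpace ℝ (Fin d), ℂ)) u
      = invFourierRd h u + a * invFourierRd g u := by
  unfold invFourierRd
  rw [← integral_const_mul, ← integral_add]
  · apply integral_congr_ae
    refine Eventually.of_forall fun x => ?_
    simp only [CompactlySupportedContinuousMap.coe_add, CompactlySupportedContinuousMap.coe_smul,
      Pi.add_apply, Pi.smul_apply, smul_eq_mul]
    ring
  · apply (cc_int h).bdd_mul (c := 1)
    · exact (by fun_prop : Continuous fun p : EuclideanSpace ℝ (Fin d) =>
          Complex.exp (Complex.I * dotc p u)).aestronglyMeasurable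
    · exact Eventually.of_forall fun p => (norm_exp_dotc _ _).le
  · apply Integrable.const_mul
    apply (cc_int g).bdd_mul (c := 1)
    · exact (by fun_prop : Continuous fun p : EuclideanSpace ℝ (Fin d) =>
          Complex.exp (Complex.I * dotc p u)).aestronglyMeasurable
    · exact Eventually.of_forall fun p => (norm_exp_dotc _ _).le

lemma int_four {f₁ f₂ f₃ f₄ : EuclideanSpace ℝ (Fin d) → ℂ} (h₁ : Integrable f₁)
    (h₂ : Integrable f₂) (h₃ : Integrable f₃) (h₄ : Integrable f₄) :
    (∫ a, f₁ a) + (∫ a, f₂ a) + (∫ a, f₃ a) + (∫ a, f₄ a) = ∫ a, (f₁ a + f₂ a + f₃ a + f₄ a) := by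
  have e₁ := integral_add h₁ h₂
  have e₂ := integral_add (h₁.add h₂) h₃
  have e₃ := integral_add ((h₁.add h₂).add h₃) h₄
  simp only [Pi.add_apply] at e₁ e₂ e₃
  rw [e₃, e₂, e₁]

lemma ccv_polar (h g : C_c(EuclideanSpace ℝ (Fin d), ℂ)) :
    (4 : ℂ) • ccv h g = (1 : ℂ) • ccv (h + (1 : ℂ) • g) (h + (1 : ℂ) • g)
      + (-1 : ℂ) • ccv (h + (-1 : ℂ) • g) (h + (-1 : ℂ) • g)
      + Complex.I • ccv (h + Complex.I • g) (h + Complex.I • g)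
      + (-Complex.I) • ccv (h + (-Complex.I) • g) (h + (-Complex.I) • g) := by
  ext x
  simp only [CompactlySupportedContinuousMap.coe_add, CompactlySupportedContinuousMap.coe_smul,
      Pi.add_apply, Pi.smul_apply, smul_eq_mul, ccv_apply]
  have H := fun a : ℂ => (ccv_int (h + a • g) (h + a • g) x).const_mul a
  simp only [CompactlySupportedContinuousMap.coe_add, CompactlySupportedContinuousMap.coe_smul,
      Pi.add_apply, Pi.smul_apply, smul_eq_mul] at H
  simp only [← integral_const_mul]
  rw [int_four (H 1) (H (-1)) (H Complex.I) (H (-Complex.I))]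
  apply integral_congr_ae
  refine Eventually.of_forall fun y => ?_
  simp only [map_add, map_mul, map_neg, map_one, Complex.conj_I]
  linear_combination (2 * h y * conj (g (y-x)) - 2 * g y * conj (h (y - x))) * Complex.I_sq

lemma polar {φ : EuclideanSpace ℝ (Fin d) → ℂ} (hφc : Continuous φ) {C : ℝ}
    (hφb : ∀ t, ‖φ t‖ ≤ C) (ν : C_c(EuclideanSpace ℝ (Fin d), ℂ) →ₗ[ℂ] ℂ)
    (hν : ∀ h k : C_c(EuclideanSpace ℝ (Fin d), ℂ),
        (∀ x, k x = ∫ y, h y * conj (h (y - x))) →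
        ν k = (((2 * Real.pi) ^ d)⁻¹ : ℝ) *
          ∫ t, (‖invFourierRd h t‖ ^ 2 : ℝ) * φ t)
    (h g : C_c(EuclideanSpace ℝ (Fin d), ℂ)) :
    ν (ccv h g) = (((2 * Real.pi) ^ d)⁻¹ : ℝ) *
      ∫ t, invFourierRd h t * conj (invFourierRd g t) * φ t := by
  have H : ∀ a : ℂ, Integrable fun t => a * (((‖invFourierRd (h + a • g : C_c(EuclideanSpace ℝ (Fin d), ℂ)) t‖ ^ 2 : ℝ) : ℂ) * φ t) := by
    intro a
    have h1 := (plancherel_int (h + a • g : C_c(EuclideanSpace ℝ (Fin d), ℂ)).continuous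
      (h + a • g : C_c(EuclideanSpace ℝ (Fin d), ℂ)).hasCompactSupport).ofReal (𝕜 := ℂ)
    exact ((h1.mul_bdd (c := C) hφc.aestronglyMeasurable (Eventually.of_forall hφb))).const_mul a
  have e := congrArg ν (ccv_polar h g)
  simp only [map_add, map_smul, smul_eq_mul] at e
  rw [hν _ _ (ccv_apply _ _), hν _ _ (ccv_apply _ _), hν _ _ (ccv_apply _ _),
    hν _ _ (ccv_apply _ _)] at e
  set c : ℂ := ((((2 * Real.pi) ^ d)⁻¹ : ℝ) : ℂ) with hc
  have e2 : 4 * ∫ t, invFourierRd h t * conj (invFourierRd g t) * φ t =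
      ((1 * ∫ t, (((‖invFourierRd (h + (1:ℂ) • g : C_c(EuclideanSpace ℝ (Fin d), ℂ)) t‖ ^ 2 : ℝ) : ℂ) * φ t))
      + ((-1) * ∫ t, (((‖invFourierRd (h + (-1:ℂ) • g : C_c(EuclideanSpace ℝ (Fin d), ℂ)) t‖ ^ 2 : ℝ) : ℂ) * φ t)))
      + (Complex.I * ∫ t, (((‖invFourierRd (h + Complex.I • g : C_c(EuclideanSpace ℝ (Fin d), ℂ)) t‖ ^ 2 : ℝ) : ℂ) * φ t))
      + ((-Complex.I) * ∫ t, (((‖invFourierRd (h + (-Complex.I) • g : C_c(EuclideanSpace ℝ (Fin d), ℂ)) t‖ ^ 2 : ℝ) : ℂ) * φ t)) := by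
    simp only [← integral_const_mul]
    rw [int_four (H 1) (H (-1)) (H Complex.I) (H (-Complex.I))]
    apply integral_congr_ae
    refine Eventually.of_forall fun y => ?_
    simp only [inv_lin]
    push_cast
    simp only [← Complex.mul_conj', map_add, map_mul, map_neg, map_one, Complex.conj_I]
    linear_combination (2 * invFourierRd h y * conj (invFourierRd g y) - 2 * invFourierRd g y * conj (invFourierRd h y)) * φ y * Complex.I_sq
  have e3 : (4:ℂ) * ν (ccv h g) = 4 * (c * ∫ t, invFourierRd h t * conj (invFourierRd g t) * φ t) := by
    rw [e]
    linear_combination (-c) * e2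
  exact mul_left_cancel₀ (by norm_num) e3

/-- the mollifier as an element of `C_c` -/
noncomputable def rhocc (d n : ℕ) : C_c(EuclideanSpace ℝ (Fin d), ℂ) :=
  ⟨⟨rhoc d n, rhoc_cont n⟩, rhoc_cs n⟩

/-- the big cutoff as an element of `C_c` -/
noncomputable def bigcc (d n : ℕ) : C_c(EuclideanSpace ℝ (Fin d), ℂ) :=
  ⟨⟨fun x => ((bigb d n x : ℝ) : ℂ), (bigbc_contDiff n).continuous⟩, bigbc_cs n⟩

lemma bigcc_apply (n : ℕ) (x : EuclideanSpace ℝ (Fin d)) :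
    bigcc d n x = ((bigb d n x : ℝ) : ℂ) := rfl

lemma bigcc_one (n : ℕ) (x : EuclideanSpace ℝ (Fin d)) (hx : ‖x‖ ≤ n + 1) : bigcc d n x = 1 := by
  rw [bigcc_apply, bigb_one n x hx]; simp

lemma nu_eq {φ : EuclideanSpace ℝ (Fin d) → ℂ} (hφc : Continuous φ) {C : ℝ}
    (hφb : ∀ t, ‖φ t‖ ≤ C) (ν : C_c(EuclideanSpace ℝ (Fin d), ℂ) →ₗ[ℂ] ℂ) (hl : LocBdd ν)
    (hν : ∀ h k : C_c(EuclideanSpace ℝ (Fin d), ℂ),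
        (∀ x, k x = ∫ y, h y * conj (h (y - x))) →
        ν k = (((2 * Real.pi) ^ d)⁻¹ : ℝ) *
          ∫ t, (‖invFourierRd h t‖ ^ 2 : ℝ) * φ t)
    (h : C_c(EuclideanSpace ℝ (Fin d), ℂ)) (hi : Integrable (invFourierRd h)) :
    ν h = (((2 * Real.pi) ^ d)⁻¹ : ℝ) * ∫ t, invFourierRd h t * φ t := by
  obtain ⟨R, hR0, hR⟩ := cs_radius h.hasCompactSupport
  obtain ⟨N, hN⟩ := exists_nat_ge R
  obtain ⟨μ, w, hμ, hw, hrep⟩ := riesz_rep ν hl (bigcc d N)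
  obtain ⟨B, hB⟩ := cc_bddC h
  have hB' := fun n => cv_rhoc_bound (d := d) n hB
  have e1 : ν h = ∫ x, h x * w x ∂μ := by
    rw [← hrep h h.continuous ⟨B, hB⟩]
    congr 1
    ext x
    change h x = bigcc d N x * h x
    by_cases hx : R < ‖x‖
    · simp [hR x hx]
    · rw [bigcc_one]
      · simp
      · linarith
  have e2 : ∀ n, ν (ccv h (rhocc d n)) = ∫ x, cv h (rhoc d n) x * w x ∂μ := by
    intro n
    rw [← hrep (cv h (rhoc d n)) (ccv h (rhocc d n)).continuous ⟨B, hB' n⟩]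
    congr 1
    ext x
    change cv h (rhoc d n) x = bigcc d N x * cv h (rhoc d n) x
    by_cases hx : R + 1 < ‖x‖
    · simp [cv_rhoc_supp n hR x hx]
    · rw [bigcc_one]
      · simp
      · linarith
  have l1 : Tendsto (fun n => ν (ccv h (rhocc d n))) atTop (𝓝 (ν h)) := by
    simp only [e1, e2]
    apply tendsto_integral_of_dominated_convergence (fun s => B * ‖w s‖)
    · intro n
      exact (ccv h (rhocc d n)).continuous.aestronglyMeasurable.mul hw.1
    · exact hw.norm.const_mul B
    · intro n
      refine Eventually.of_forall fun s => ?_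
      rw [norm_mul]
      gcongr
      exact hB' n s
    · exact Eventually.of_forall fun s => (cv_rhoc_tendsto' s h.continuous).mul_const _
  have l2 : Tendsto (fun n => (((2 * Real.pi) ^ d)⁻¹ : ℝ) *
      ∫ t, invFourierRd h t * conj (invFourierRd (rhoc d n) t) * φ t) atTop
      (𝓝 ((((2 * Real.pi) ^ d)⁻¹ : ℝ) * ∫ t, invFourierRd h t * φ t)) := by
    apply Tendsto.const_mul
    apply tendsto_integral_of_dominated_convergence (fun t => ‖invFourierRd h t‖ * C)
    · intro n
      have := inv_continuous (cs_integrable (rhoc_cont (d := d) n) (rhoc_cs n))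
      exact (hi.1.mul (Complex.continuous_conj.comp this).aestronglyMeasurable).mul
        hφc.aestronglyMeasurable
    · exact hi.norm.mul_const C
    · intro n
      refine Eventually.of_forall fun t => ?_
      rw [norm_mul, norm_mul, RCLike.norm_conj]
      have := inv_rhoc_norm (d := d) n t
      have := hφb t
      gcongr
      exact mul_le_of_le_one_right (norm_nonneg _) (inv_rhoc_norm n t)
    · refine Eventually.of_forall fun t => ?_
      have := ((Complex.continuous_conj.tendsto _).comp (inv_rhoc_tendsto t)).const_mul (invFourierRd h t)
      simpa using this.mul_const (φ t)
  refine tendsto_nhds_unique l1 (l2.congr fun n => ?_)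
  rw [polar hφc hφb ν hν]
  rfl

lemma inv_exp_mul (k : EuclideanSpace ℝ (Fin d) → ℂ) (t u : EuclideanSpace ℝ (Fin d)) :
    invFourierRd (fun x => k x * Complex.exp (-(Complex.I * dotc x t))) u = invFourierRd k (u - t) := by
  unfold invFourierRd
  congr 1
  ext x
  rw [sub_eq_add_neg, dotc_add_right, dotc_neg_right, mul_add, Complex.exp_add, mul_neg]
  ring

theorem forward_dir {φ : EuclideanSpace ℝ (Fin d) → ℂ} (hφc : Continuous φ) {C : ℝ}
    (hφb : ∀ t, ‖φ t‖ ≤ C) (ν : C_c(EuclideanSpace ℝ (Fin d), ℂ) →ₗ[ℂ] ℂ) (hl : LocBdd ν)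
    (hν : ∀ h k : C_c(EuclideanSpace ℝ (Fin d), ℂ),
        (∀ x, k x = ∫ y, h y * conj (h (y - x))) →
        ν k = (((2 * Real.pi) ^ d)⁻¹ : ℝ) *
          ∫ t, (‖invFourierRd h t‖ ^ 2 : ℝ) * φ t)
    (k : C_c(EuclideanSpace ℝ (Fin d), ℂ))
    (ν₀ : Measure (EuclideanSpace ℝ (Fin d))) [IsFiniteMeasure ν₀]
    (g₀ : EuclideanSpace ℝ (Fin d) → ℂ) (hg : Integrable g₀ ν₀)
    (hk : ∀ x, k x = ∫ t, Complex.exp (Complex.I * dotc x t) * g₀ t ∂ν₀) :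
      ∃ (ν₁ : Measure (EuclideanSpace ℝ (Fin d)))
        (g₁ : EuclideanSpace ℝ (Fin d) → ℂ),
        IsFiniteMeasure ν₁ ∧ Integrable g₁ ν₁ ∧
        ∀ t, ∫ x, Complex.exp (-(Complex.I * dotc x t)) * g₁ x ∂ν₁ =
          ∫ s, φ (t - s) * g₀ s ∂ν₀ := by
  obtain ⟨μ, w, hμ, hw, hrep⟩ := riesz_rep ν hl k
  refine ⟨μ, w, hμ, hw, fun t => ?_⟩
  have hec : Continuous fun x : EuclideanSpace ℝ (Fin d) => Complex.exp (-(Complex.I * dotc x t)) := by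
    fun_prop
  rw [← hrep _ hec ⟨1, fun x => (norm_exp_neg_dotc _ _).le⟩]
  have hki := inv_k_integrable hg k.hasCompactSupport hk
  have hinv : invFourierRd (ccMul k _ hec) = fun u => invFourierRd k (u - t) := by
    ext u
    exact inv_exp_mul k t u
  rw [nu_eq hφc hφb ν hl hν _ (by rw [hinv]; exact hki.comp_sub_right t), hinv,
    uniq_general hg k.continuous k.hasCompactSupport hk (F := fun s => φ (t - s)) (by fun_prop)
      (fun s => hφb _)]
  congr 1
  rw [← integral_add_right_eq_self _ t]
  congr 1
  ext u
  simp only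
  rw [add_sub_cancel_right, sub_neg_eq_add, add_comm u t, mul_comm]
  rfl

end Forward


section Backward
open scoped FourierTransform Convolution ContDiff

variable {d : ℕ}

lemma density_rep {F : EuclideanSpace ℝ (Fin d) → ℂ} (hFc : Continuous F) (hF : Integrable F) :
    ∃ (ν₀ : Measure (EuclideanSpace ℝ (Fin d))) (g₀ : EuclideanSpace ℝ (Fin d) → ℂ),
      IsFiniteMeasure ν₀ ∧ Integrable g₀ ν₀ ∧
      ∀ ψ : EuclideanSpace ℝ (Fin d) → ℂ, ∫ t, ψ t * g₀ t ∂ν₀ = ∫ t, ψ t * F t := by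
  have hfin : IsFiniteMeasure (volume.withDensity fun x => ((‖F x‖₊ : NNReal) : ℝ≥0∞)) :=
    isFiniteMeasure_withDensity hF.2.ne
  refine ⟨volume.withDensity fun x => ((‖F x‖₊ : NNReal) : ℝ≥0∞),
    fun x => F x / (‖F x‖ : ℂ), hfin, ?_, fun ψ => ?_⟩
  · apply Integrable.of_bound (C := 1)
    · apply Measurable.aestronglyMeasurable
      exact hFc.measurable.div (Complex.continuous_ofReal.comp hFc.norm).measurable
    · refine Eventually.of_forall fun x => ?_
      rw [norm_div, Complex.norm_real, norm_norm]
      exact div_self_le_one _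
  · rw [integral_withDensity_eq_integral_smul hFc.nnnorm.measurable]
    congr 1
    ext t
    rw [NNReal.smul_def, Complex.real_smul, coe_nnnorm]
    by_cases h : F t = 0
    · simp [h]
    · have : (‖F t‖ : ℂ) ≠ 0 := by simpa using h
      field_simp

lemma bigcc_rep (N : ℕ) :
    ∃ (ν₀ : Measure (EuclideanSpace ℝ (Fin d))) (g₀ : EuclideanSpace ℝ (Fin d) → ℂ),
      IsFiniteMeasure ν₀ ∧ Integrable g₀ ν₀ ∧
      ∀ x, bigcc d N x = ∫ t, Complex.exp (Complex.I * dotc x t) * g₀ t ∂ν₀ := by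
  have hi := cc_int (bigcc d N)
  have hi' : Integrable (invFourierRd (bigcc d N)) :=
    inv_integrable_of_smooth (bigbc_contDiff (d := d) N) (bigbc_cs N)
  obtain ⟨ν₀, g₀, h1, h2, h3⟩ := density_rep (d := d)
    (F := fun t => ((((2 * Real.pi) ^ d)⁻¹ : ℝ) : ℂ) * invFourierRd (bigcc d N) (-t))
    (continuous_const.mul ((inv_continuous hi).comp continuous_neg)) (hi'.comp_neg.const_mul _)
  refine ⟨ν₀, g₀, h1, h2, fun x => ?_⟩
  rw [h3, inv_inversion (f := bigcc d N) (bigcc d N).continuous hi hi' x, ← integral_const_mul,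
    ← integral_neg_eq_self]
  congr 1
  ext t
  rw [dotc_neg_right, mul_neg, neg_neg]
  ring

theorem backward_dir {φ : EuclideanSpace ℝ (Fin d) → ℂ} (hφc : Continuous φ) {C : ℝ}
    (hφb : ∀ t, ‖φ t‖ ≤ C)
    (H : ∀ (k : C_c(EuclideanSpace ℝ (Fin d), ℂ))
        (ν₀ : Measure (EuclideanSpace ℝ (Fin d)))
        (g₀ : EuclideanSpace ℝ (Fin d) → ℂ),
      IsFiniteMeasure ν₀ → Integrable g₀ ν₀ →
      (∀ x, k x = ∫ t, Complex.exp (Complex.I * dotc x t) * g₀ t ∂ν₀) →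
      ∃ (ν₁ : Measure (EuclideanSpace ℝ (Fin d)))
        (g₁ : EuclideanSpace ℝ (Fin d) → ℂ),
        IsFiniteMeasure ν₁ ∧ Integrable g₁ ν₁ ∧
        ∀ t, ∫ x, Complex.exp (-(Complex.I * dotc x t)) * g₁ x ∂ν₁ =
          ∫ s, φ (t - s) * g₀ s ∂ν₀) :
    ∃ ν : C_c(EuclideanSpace ℝ (Fin d), ℂ) →ₗ[ℂ] ℂ, LocBdd ν ∧
      (∀ h k : C_c(EuclideanSpace ℝ (Fin d), ℂ),
        (∀ x, k x = ∫ y, h y * conj (h (y - x))) →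
        ν k = (((2 * Real.pi) ^ d)⁻¹ : ℝ) *
          ∫ t, (‖invFourierRd h t‖ ^ 2 : ℝ) * φ t) := by
  set c : ℂ := ((((2 * Real.pi) ^ d)⁻¹ : ℝ) : ℂ) with hc
  have H1 : ∀ N : ℕ, ∃ (m : Measure (EuclideanSpace ℝ (Fin d)))
      (w : EuclideanSpace ℝ (Fin d) → ℂ), IsFiniteMeasure m ∧ Integrable w m ∧
      ∀ f : EuclideanSpace ℝ (Fin d) → ℂ, Continuous f → Integrable f →
        Integrable (invFourierRd f) → (∀ x, (N : ℝ) + 1 < ‖x‖ → f x = 0) →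
        ∫ x, f x * w x ∂m = c * ∫ u, invFourierRd f u * φ u := by
    intro N
    obtain ⟨ν₀, g₀, h1, h2, h3⟩ := bigcc_rep (d := d) N
    obtain ⟨m, w, h4, h5, h6⟩ := H (bigcc d N) ν₀ g₀ h1 h2 h3
    refine ⟨m, w, h4, h5, fun f hf hfi hfi' hs => ?_⟩
    rw [pairing_A hφc hφb h2 h5 h3 h6 hf hfi hfi']
    have : (fun x => f x * bigcc d N x) = f := by
      ext x
      by_cases hx : (N : ℝ) + 1 < ‖x‖
      · simp [hs x hx]
      · rw [bigcc_one N x (not_lt.mp hx), mul_one]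
    rw [this]
  choose m w hm hw hT using H1
  have hint : ∀ N (f : C_c(EuclideanSpace ℝ (Fin d), ℂ)), Integrable (fun x => f x * w N x) (m N) := by
    intro N f
    obtain ⟨B, hB⟩ := cc_bddC f
    exact (hw N).bdd_mul (c := B) f.continuous.aestronglyMeasurable (Eventually.of_forall hB)
  have lim : ∀ N (f : C_c(EuclideanSpace ℝ (Fin d), ℂ)),
      Tendsto (fun n => ∫ x, cv f (rhoc d n) x * w N x ∂(m N)) atTop
        (𝓝 (∫ x, f x * w N x ∂(m N))) := by
    intro N f
    obtain ⟨B, hB⟩ := cc_bddC f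
    apply tendsto_integral_of_dominated_convergence (fun s => B * ‖w N s‖)
    · intro n
      exact (ccv f (rhocc d n)).continuous.aestronglyMeasurable.mul (hw N).1
    · exact (hw N).norm.const_mul B
    · intro n
      refine Eventually.of_forall fun s => ?_
      rw [norm_mul]
      gcongr
      exact cv_rhoc_bound n hB s
    · exact Eventually.of_forall fun s => (cv_rhoc_tendsto' s f.continuous).mul_const _
  have cons : ∀ (N M : ℕ) (f : C_c(EuclideanSpace ℝ (Fin d), ℂ)),
      (∀ x, (N : ℝ) < ‖x‖ → f x = 0) → (∀ x, (M : ℝ) < ‖x‖ → f x = 0) →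
      ∫ x, f x * w N x ∂(m N) = ∫ x, f x * w M x ∂(m M) := by
    intro N M f hN hM
    refine tendsto_nhds_unique (lim N f) ((lim M f).congr fun n => ?_)
    have s1 : ContDiff ℝ ∞ (cv f (rhoc d n)) := cv_rhoc_contDiff n f.continuous
    have s2 : HasCompactSupport (cv f (rhoc d n)) := (ccv f (rhocc d n)).hasCompactSupport
    have s3 := cs_integrable s1.continuous s2
    have s4 := inv_integrable_of_smooth s1 s2
    rw [hT M _ s1.continuous s3 s4 (cv_rhoc_supp n hM), hT N _ s1.continuous s3 s4 (cv_rhoc_supp n hN)]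
  have hrad : ∀ f : C_c(EuclideanSpace ℝ (Fin d), ℂ), ∃ N : ℕ, ∀ x, (N : ℝ) < ‖x‖ → f x = 0 := by
    intro f
    obtain ⟨R, hR0, hR⟩ := cs_radius f.hasCompactSupport
    obtain ⟨N, hN⟩ := exists_nat_ge R
    exact ⟨N, fun x hx => hR x (hN.trans_lt hx)⟩
  choose rad hrad using hrad
  have key : ∀ (f : C_c(EuclideanSpace ℝ (Fin d), ℂ)) (N : ℕ), (∀ x, (N : ℝ) < ‖x‖ → f x = 0) →
      ∫ x, f x * w (rad f) x ∂(m (rad f)) = ∫ x, f x * w N x ∂(m N) :=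
    fun f N hN => cons _ _ f (hrad f) hN
  let ν : C_c(EuclideanSpace ℝ (Fin d), ℂ) →ₗ[ℂ] ℂ :=
    { toFun := fun f => ∫ x, f x * w (rad f) x ∂(m (rad f))
      map_add' := by
        intro f g
        have hf : ∀ x, ((max (rad f) (rad g) : ℕ) : ℝ) < ‖x‖ → f x = 0 := fun x hx =>
          hrad f x (lt_of_le_of_lt (by exact_mod_cast le_max_left _ _) hx)
        have hg : ∀ x, ((max (rad f) (rad g) : ℕ) : ℝ) < ‖x‖ → g x = 0 := fun x hx =>
          hrad g x (lt_of_le_of_lt (by exact_mod_cast le_max_right _ _) hx)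
        rw [key f _ hf, key g _ hg, key (f + g) (max (rad f) (rad g)) (fun x hx => by
          simp [hf x hx, hg x hx]), ← integral_add (hint _ f) (hint _ g)]
        congr 1
        ext x
        simp [add_mul]
      map_smul' := by
        intro a f
        rw [key (a • f) (rad f) (fun x hx => by simp [hrad f x hx]), RingHom.id_apply, smul_eq_mul,
          ← integral_const_mul]
        congr 1
        ext x
        simp [mul_assoc] }
  have hνd : ∀ f, ν f = ∫ x, f x * w (rad f) x ∂(m (rad f)) := fun f => rfl
  refine ⟨ν, fun K hK => ?_, fun h k hk => ?_⟩
  · obtain ⟨R, hR⟩ := hK.isBounded.subset_closedBall 0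
    obtain ⟨N, hN⟩ := exists_nat_ge R
    refine ⟨∫ x, ‖w N x‖ ∂(m N), fun h hs => ?_⟩
    rw [hνd, key h N]
    · obtain ⟨B, hB⟩ := cc_bddC h
      have hbdd : BddAbove (Set.range fun x => ‖h x‖) := ⟨B, by rintro _ ⟨x, rfl⟩; exact hB x⟩
      rw [← integral_mul_const]
      apply norm_integral_le_of_norm_le ((hw N).norm.mul_const _)
      refine Eventually.of_forall fun x => ?_
      rw [norm_mul, mul_comm]
      gcongr
      exact le_ciSup hbdd x
    · intro x hx
      by_contra hne
      have h1 := hR (hs (subset_tsupport _ (Function.mem_support.mpr hne)))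
      rw [mem_closedBall_zero_iff] at h1
      linarith
  · have hkc : (k : EuclideanSpace ℝ (Fin d) → ℂ) = cv h h := funext hk
    have hinv : ∀ u, invFourierRd k u = ((‖invFourierRd h u‖ ^ 2 : ℝ) : ℂ) := by
      intro u
      rw [hkc, inv_cv (cc_int h) (cc_int h), Complex.mul_conj']
      push_cast
      rfl
    have hki : Integrable (invFourierRd k) := by
      refine ((plancherel_int h.continuous h.hasCompactSupport).ofReal (𝕜 := ℂ)).congr
        (Eventually.of_forall fun u => ?_)
      exact (hinv u).symm
    rw [hνd, hT _ k k.continuous (cc_int k) hki (fun x hx => hrad k x (by linarith))]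
    simp only [hinv]

end Backward


theorem stmt19 (d : ℕ) (hd : 1 ≤ d)
    (φ : EuclideanSpace ℝ (Fin d) → ℂ)
    (hφc : Continuous φ) (hφb : ∃ C : ℝ, ∀ t, ‖φ t‖ ≤ C)
    (hφ : bseNorm (rdPair d) φ
      (Metric.closedBall (0 : EuclideanSpace ℝ (Fin d)) (1 / 4)) ≠ ⊤) :
    (∃ ν : C_c(EuclideanSpace ℝ (Fin d), ℂ) →ₗ[ℂ] ℂ,
      (∀ K : Set (EuclideanSpace ℝ (Fin d)), IsCompact K →
        ∃ C : ℝ, ∀ h : C_c(EuclideanSpace ℝ (Fin d), ℂ),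
          tsupport h ⊆ K → ‖ν h‖ ≤ C * ⨆ x, ‖h x‖) ∧
      (∀ h k : C_c(EuclideanSpace ℝ (Fin d), ℂ),
        (∀ x, k x = ∫ y, h y * conj (h (y - x))) →
        ν k = (((2 * Real.pi) ^ d)⁻¹ : ℝ) *
          ∫ t, (‖invFourierRd h t‖ ^ 2 : ℝ) * φ t))
    ↔
    (∀ (k : C_c(EuclideanSpace ℝ (Fin d), ℂ))
        (ν₀ : Measure (EuclideanSpace ℝ (Fin d)))
        (g₀ : EuclideanSpace ℝ (Fin d) → ℂ),
      IsFiniteMeasure ν₀ → Integrable g₀ ν₀ →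
      (∀ x, k x = ∫ t, Complex.exp (Complex.I * dotc x t) * g₀ t ∂ν₀) →
      ∃ (ν₁ : Measure (EuclideanSpace ℝ (Fin d)))
        (g₁ : EuclideanSpace ℝ (Fin d) → ℂ),
        IsFiniteMeasure ν₁ ∧ Integrable g₁ ν₁ ∧
        ∀ t, ∫ x, Complex.exp (-(Complex.I * dotc x t)) * g₁ x ∂ν₁ =
          ∫ s, φ (t - s) * g₀ s ∂ν₀) := by
  obtain ⟨C, hC⟩ := hφb
  constructor
  · rintro ⟨ν, hl, hν⟩ k ν₀ g₀ hfin hg hk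
    exact forward_dir hφc hC ν hl hν k ν₀ g₀ hg hk
  · intro H
    exact backward_dir hφc hC H
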